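/- Let U, Y₁, Y be Hilbert spaces, S₁ ∈ S_{κ₁}(U,Y₁), S₂ ∈ S_{κ₂}(Y₁,Y), and let Σ₁ = (A₁,B₁,C₁,D₁;X₁,U,Y₁;κ₁) and Σ₂ = (A₂,B₂,C₂,D₂;X₂,Y₁,Y;κ₂) be isometric controllable realizations of S₁ and S₂, respectively. Set S = S₂S₁ and write S^#(z) := (S(conj(z)))*. Then Σ₂∘Σ₁ is an isometric controllable realization of S if and only if the following two conditions hold: (i) H(S^#) = S₁^#·H(S₂^#) ⊕ H(S₁^#), i.e. every h ∈ H(S^#) can be written uniquely as h = S₁^#h₂ + h₁ with h₂ ∈ H(S₂^#) and h₁ ∈ H(S₁^#), the inclusion of H(S₁^#) into H(S^#) is isometric, and [S₁^#h₂, h₁]_{H(S^#)} = 0 for all h₂ ∈ H(S₂^#), h₁ ∈ H(S₁^#); and (ii) the map h₂ ↦ S₁^#h₂ is an isometry of H(S₂^#) into H(S^#), i.e. [S₁^#h₂, S₁^#h₂']_{H(S^#)} = [h₂,h₂']_{H(S₂^#)} for all h₂, h₂' ∈ H(S₂^#). -/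

import Mathlib

open MeasureTheory ContinuousLinearMap Filter Topology Metric
open scoped ComplexConjugate

noncomputable section

notation "⟪" x ", " y "⟫" => @inner ℂ _ _ x y

namespace Pontryagin

variable {X X' U Y : Type*}

section Ops

variable [NormedAddCommGroup X] [InnerProductSpace ℂ X] [CompleteSpace X]
  [NormedAddCommGroup X'] [InnerProductSpace ℂ X'] [CompleteSpace X']
  [NormedAddCommGroup U] [InnerProductSpace ℂ U] [CompleteSpace U]
  [NormedAddCommGroup Y] [InnerProductSpace ℂ Y] [CompleteSpace Y]

/-- `J` is a fundamental symmetry of negative index `κ`: a self-adjoint unitary whose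
eigenspace for `-1` (i.e. `ker (J + I)`) has dimension `κ`. -/
def IsFundamentalSymmetry (J : X →L[ℂ] X) (κ : ℕ) : Prop :=
  IsSelfAdjoint J ∧ J ∘L J = ContinuousLinearMap.id ℂ X ∧
    Module.finrank ℂ (LinearMap.ker ((J : X →ₗ[ℂ] X) + LinearMap.id)) = κ

/-- indefinite adjoint `T^[*] = J_X T* J_Y` of `T : X →L Y`. -/
def iadj (JX : X →L[ℂ] X) (JY : Y →L[ℂ] Y) (T : X →L[ℂ] Y) : Y →L[ℂ] X :=
  JX ∘L (ContinuousLinearMap.adjoint T) ∘L JY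

/-- the controllable subspace `X^c`. -/
def ctrlSpace (A : X →L[ℂ] X) (B : U →L[ℂ] X) : Submodule ℂ X :=
  (⨆ n : ℕ, LinearMap.range (((A ^ n) ∘L B) : U →ₗ[ℂ] X)).topologicalClosure

/-- the observable subspace `X^o`. -/
def obsSpace (JX : X →L[ℂ] X) (A : X →L[ℂ] X) (C : X →L[ℂ] Y) : Submodule ℂ X :=
  ctrlSpace (iadj JX JX A) (JX ∘L ContinuousLinearMap.adjoint C)

/-- the simple subspace `X^s`. -/
def simpleSpace (JX : X →L[ℂ] X) (A : X →L[ℂ] X) (B : U →L[ℂ] X) (C : X →L[ℂ] Y) :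
    Submodule ℂ X :=
  (ctrlSpace A B ⊔ obsSpace JX A C).topologicalClosure

/-- the `[·,·]`-orthogonal companion `M^[⊥]` of `M`. -/
def iOrtho (JX : X →L[ℂ] X) (M : Submodule ℂ X) : Submodule ℂ X :=
  Submodule.comap (JX : X →ₗ[ℂ] X) Mᗮ

/-- `M` is a Hilbert subspace: closed and positive definite for `[·,·]`. -/
def IsHilbertSubspace (JX : X →L[ℂ] X) (M : Submodule ℂ X) : Prop :=
  IsClosed (M : Set X) ∧ ∀ x ∈ M, x ≠ 0 → 0 < (⟪JX x, x⟫).re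

/-- `M` is an anti-Hilbert subspace: closed and negative definite for `[·,·]`. -/
def IsAntiHilbertSubspace (JX : X →L[ℂ] X) (M : Submodule ℂ X) : Prop :=
  IsClosed (M : Set X) ∧ ∀ x ∈ M, x ≠ 0 → (⟪JX x, x⟫).re < 0

/-- a fundamental decomposition `X = P ∔ M`. -/
def IsFundDecomp (JX : X →L[ℂ] X) (P M : Submodule ℂ X) : Prop :=
  IsHilbertSubspace JX P ∧ IsAntiHilbertSubspace JX M ∧
    (∀ x ∈ P, ∀ y ∈ M, ⟪JX x, y⟫ = 0) ∧ P ⊓ M = ⊥ ∧ P ⊔ M = ⊤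

/-- passivity: the system operator is a contraction for the indefinite metrics. -/
def IsPassive (JX : X →L[ℂ] X) (A : X →L[ℂ] X) (B : U →L[ℂ] X) (C : X →L[ℂ] Y)
    (D : U →L[ℂ] Y) : Prop :=
  ∀ (x : X) (u : U),
    (⟪JX (A x + B u), A x + B u⟫).re + ‖C x + D u‖ ^ 2 ≤ (⟪JX x, x⟫).re + ‖u‖ ^ 2

/-- the system operator is isometric: `T^[*] T = I`. -/
def IsIsometricSys (JX : X →L[ℂ] X) (A : X →L[ℂ] X) (B : U →L[ℂ] X) (C : X →L[ℂ] Y)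
    (D : U →L[ℂ] Y) : Prop :=
  ∀ (x x' : X) (u u' : U),
    ⟪JX (A x + B u), A x' + B u'⟫ + ⟪C x + D u, C x' + D u'⟫ = ⟪JX x, x'⟫ + ⟪u, u'⟫

/-- the system operator is co-isometric: `T T^[*] = I`, i.e. `T^[*]` is isometric. -/
def IsCoisometricSys (JX : X →L[ℂ] X) (A : X →L[ℂ] X) (B : U →L[ℂ] X) (C : X →L[ℂ] Y)
    (D : U →L[ℂ] Y) : Prop :=
  ∀ (x x' : X) (y y' : Y),
    ⟪JX (iadj JX JX A x + (JX ∘L ContinuousLinearMap.adjoint C) y),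
        iadj JX JX A x' + (JX ∘L ContinuousLinearMap.adjoint C) y'⟫
      + ⟪(ContinuousLinearMap.adjoint B ∘L JX) x + ContinuousLinearMap.adjoint D y,
          (ContinuousLinearMap.adjoint B ∘L JX) x' + ContinuousLinearMap.adjoint D y'⟫
      = ⟪JX x, x'⟫ + ⟪y, y'⟫

def IsConservativeSys (JX : X →L[ℂ] X) (A : X →L[ℂ] X) (B : U →L[ℂ] X) (C : X →L[ℂ] Y)
    (D : U →L[ℂ] Y) : Prop :=
  IsIsometricSys JX A B C D ∧ IsCoisometricSys JX A B C D

/-- the value `D + z C (I - zA)⁻¹ B` of the transfer function. -/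
def transferAt (A : X →L[ℂ] X) (B : U →L[ℂ] X) (C : X →L[ℂ] Y) (D : U →L[ℂ] Y)
    (z : ℂ) : U →L[ℂ] Y :=
  D + z • (C ∘L (Ring.inverse ((1 : X →L[ℂ] X) - z • A)) ∘L B)

/-- the system realizes `θ` (in a neighbourhood of the origin). -/
def IsRealizationOf (A : X →L[ℂ] X) (B : U →L[ℂ] X) (C : X →L[ℂ] Y) (D : U →L[ℂ] Y)
    (θ : ℂ → (U →L[ℂ] Y)) : Prop :=
  ∃ ε > (0 : ℝ), ∀ z : ℂ, ‖z‖ < ε →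
    IsUnit ((1 : X →L[ℂ] X) - z • A) ∧ transferAt A B C D z = θ z

/-- the system realizes the (pointwise) inverse of `Bf` near the origin. -/
def IsRealizationOfInv (A : X →L[ℂ] X) (B : U →L[ℂ] X) (C : X →L[ℂ] U) (D : U →L[ℂ] U)
    (Bf : ℂ → (U →L[ℂ] U)) : Prop :=
  ∃ ε > (0 : ℝ), ∀ z : ℂ, ‖z‖ < ε →
    IsUnit ((1 : X →L[ℂ] X) - z • A) ∧
      transferAt A B C D z ∘L Bf z = 1 ∧ Bf z ∘L transferAt A B C D z = 1

end Ops

section Schur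

variable [NormedAddCommGroup U] [InnerProductSpace ℂ U] [CompleteSpace U]
  [NormedAddCommGroup Y] [InnerProductSpace ℂ Y] [CompleteSpace Y]

/-- the Schur kernel `K_S(w,z) = (I - S(z)S(w)*)/(1 - z conj w)`. -/
def schurKernel (S : ℂ → (U →L[ℂ] Y)) (w z : ℂ) : Y →L[ℂ] Y :=
  ((1 : ℂ) - z * (starRingEnd ℂ w))⁻¹ •
    ((1 : Y →L[ℂ] Y) - (S z) ∘L ContinuousLinearMap.adjoint (S w))

/-- the quadratic form `c ↦ ∑ conj (c i) * c j * ⟨K(w j, w i) (f j), f i⟩` is negative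
definite on the subspace `V`. -/
def KernelNegOn (S : ℂ → (U →L[ℂ] Y)) {n : ℕ} (w : Fin n → ℂ) (f : Fin n → Y)
    (V : Submodule ℂ (Fin n → ℂ)) : Prop :=
  ∀ c ∈ V, c ≠ 0 →
    (∑ i, ∑ j, (starRingEnd ℂ (c i)) * c j * ⟪schurKernel S (w j) (w i) (f j), f i⟫).re < 0

/-- membership of the generalized Schur class `S_κ(U,Y)` for a function holomorphic on `Ω`. -/
structure MemGenSchur (S : ℂ → (U →L[ℂ] Y)) (Ω : Set ℂ) (κ : ℕ) : Prop where
  isOpen : IsOpen Ω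
  zero_mem : (0 : ℂ) ∈ Ω
  subset : Ω ⊆ ball (0 : ℂ) 1
  holo : DifferentiableOn ℂ S Ω
  negSq_le : ∀ (n : ℕ) (w : Fin n → ℂ), (∀ i, w i ∈ Ω) → ∀ (f : Fin n → Y)
      (V : Submodule ℂ (Fin n → ℂ)), KernelNegOn S w f V → Module.finrank ℂ V ≤ κ
  negSq_attained : ∃ (n : ℕ) (w : Fin n → ℂ), (∀ i, w i ∈ Ω) ∧ ∃ (f : Fin n → Y)
      (V : Submodule ℂ (Fin n → ℂ)), KernelNegOn S w f V ∧ Module.finrank ℂ V = κ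

/-- the classical Schur class `S(U,Y) = S₀(U,Y)`. -/
def MemSchurClassZero (S : ℂ → (U →L[ℂ] Y)) : Prop :=
  DifferentiableOn ℂ S (ball (0 : ℂ) 1) ∧ ∀ z ∈ ball (0 : ℂ) 1, ‖S z‖ ≤ 1

/-- a simple Blaschke–Potapov factor. -/
def blaschkeFactor (P : U →L[ℂ] U) (ρ α z : ℂ) : U →L[ℂ] U :=
  ((1 : U →L[ℂ] U) - P) + (ρ * ((z - α) / (1 - (starRingEnd ℂ α) * z))) • P

/-- a Blaschke product of degree `κ`. -/
def IsBlaschkeProd (κ : ℕ) (Bf : ℂ → (U →L[ℂ] U)) : Prop :=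
  ∃ (P : Fin κ → (U →L[ℂ] U)) (ρ α : Fin κ → ℂ),
    (∀ k, IsSelfAdjoint (P k) ∧ P k ∘L P k = P k ∧
        Module.finrank ℂ (LinearMap.range ((P k : U →ₗ[ℂ] U))) = 1) ∧
    (∀ k, ‖ρ k‖ = 1) ∧ (∀ k, 0 < ‖α k‖ ∧ ‖α k‖ < 1) ∧
    ∀ z, Bf z = (List.ofFn (fun k => blaschkeFactor (P k) (ρ k) (α k) z)).prod

end Schur

section KL

variable [NormedAddCommGroup U] [InnerProductSpace ℂ U] [CompleteSpace U]
  [NormedAddCommGroup Y] [InnerProductSpace ℂ Y] [CompleteSpace Y]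

/-- a right Kreĭn–Langer factorization `θ = θr · Br⁻¹` on `Ω`. -/
def IsRightKLFact (θ θr : ℂ → (U →L[ℂ] Y)) (Br : ℂ → (U →L[ℂ] U)) (Ω : Set ℂ)
    (κ : ℕ) : Prop :=
  MemSchurClassZero θr ∧ IsBlaschkeProd κ Br ∧ (∀ z ∈ Ω, θ z ∘L Br z = θr z) ∧
    ∀ w ∈ ball (0 : ℂ) 1, ∀ f : U, Br w f = 0 → θr w f = 0 → f = 0

/-- a left Kreĭn–Langer factorization `θ = Bl⁻¹ · θl` on `Ω`. -/
def IsLeftKLFact (θ θl : ℂ → (U →L[ℂ] Y)) (Bl : ℂ → (Y →L[ℂ] Y)) (Ω : Set ℂ)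
    (κ : ℕ) : Prop :=
  MemSchurClassZero θl ∧ IsBlaschkeProd κ Bl ∧ (∀ z ∈ Ω, Bl z ∘L θ z = θl z) ∧
    ∀ w ∈ ball (0 : ℂ) 1, ∀ g : Y,
      ContinuousLinearMap.adjoint (Bl w) g = 0 →
      ContinuousLinearMap.adjoint (θl w) g = 0 → g = 0

end KL

section Prod2

variable (X₁ X₂ : Type*) [NormedAddCommGroup X₁] [InnerProductSpace ℂ X₁] [CompleteSpace X₁]
  [NormedAddCommGroup X₂] [InnerProductSpace ℂ X₂] [CompleteSpace X₂]

/-- the state space `X₁ ⊕ X₂` of a product of systems. -/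
abbrev ProdState := WithLp 2 (X₁ × X₂)

variable {X₁ X₂}
  {U Y₁ Y : Type*} [NormedAddCommGroup U] [InnerProductSpace ℂ U] [CompleteSpace U]
  [NormedAddCommGroup Y₁] [InnerProductSpace ℂ Y₁] [CompleteSpace Y₁]
  [NormedAddCommGroup Y] [InnerProductSpace ℂ Y] [CompleteSpace Y]

/-- identification of `ProdState X₁ X₂` with `X₁ × X₂`. -/
def eP : ProdState X₁ X₂ ≃L[ℂ] X₁ × X₂ := WithLp.prodContinuousLinearEquiv 2 ℂ X₁ X₂

/-- the fundamental symmetry `J₁ ⊕ J₂` on the product state space. -/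
def prodJ (J₁ : X₁ →L[ℂ] X₁) (J₂ : X₂ →L[ℂ] X₂) :
    ProdState X₁ X₂ →L[ℂ] ProdState X₁ X₂ :=
  eP.symm.toContinuousLinearMap ∘L
    ((J₁ ∘L fst ℂ X₁ X₂).prod (J₂ ∘L snd ℂ X₁ X₂)) ∘L eP.toContinuousLinearMap

/-- main operator `[[A₁, 0], [B₂C₁, A₂]]` of the product system `Σ₂ ∘ Σ₁`. -/
def prodA (A₁ : X₁ →L[ℂ] X₁) (C₁ : X₁ →L[ℂ] Y₁) (A₂ : X₂ →L[ℂ] X₂) (B₂ : Y₁ →L[ℂ] X₂) :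
    ProdState X₁ X₂ →L[ℂ] ProdState X₁ X₂ :=
  eP.symm.toContinuousLinearMap ∘L
    ((A₁ ∘L fst ℂ X₁ X₂).prod ((B₂ ∘L C₁ ∘L fst ℂ X₁ X₂) + (A₂ ∘L snd ℂ X₁ X₂))) ∘L
      eP.toContinuousLinearMap

/-- control operator `[B₁; B₂D₁]` of the product system `Σ₂ ∘ Σ₁`. -/
def prodB (B₁ : U →L[ℂ] X₁) (D₁ : U →L[ℂ] Y₁) (B₂ : Y₁ →L[ℂ] X₂) :
    U →L[ℂ] ProdState X₁ X₂ :=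
  eP.symm.toContinuousLinearMap ∘L (B₁.prod (B₂ ∘L D₁))

/-- observation operator `[D₂C₁, C₂]` of the product system `Σ₂ ∘ Σ₁`. -/
def prodC (C₁ : X₁ →L[ℂ] Y₁) (C₂ : X₂ →L[ℂ] Y) (D₂ : Y₁ →L[ℂ] Y) :
    ProdState X₁ X₂ →L[ℂ] Y :=
  ((D₂ ∘L C₁).coprod C₂) ∘L eP.toContinuousLinearMap

/-- feedthrough operator `D₂D₁` of the product system `Σ₂ ∘ Σ₁`. -/
def prodD (D₁ : U →L[ℂ] Y₁) (D₂ : Y₁ →L[ℂ] Y) : U →L[ℂ] Y := D₂ ∘L D₁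

end Prod2

section Boundary

variable [NormedAddCommGroup U] [InnerProductSpace ℂ U] [CompleteSpace U]
  [NormedAddCommGroup Y] [InnerProductSpace ℂ Y] [CompleteSpace Y]

/-- `T` is the strong radial limit of `θ` at the boundary point `exp(i t)`. -/
def RadialLimitAt (θ : ℂ → (U →L[ℂ] Y)) (t : ℝ) (T : U →L[ℂ] Y) : Prop :=
  ∀ u : U, Tendsto (fun r : ℝ => θ ((r : ℂ) * Complex.exp (Complex.I * t)) u)
    (𝓝[<] (1 : ℝ)) (𝓝 (T u))

/-- the strong radial boundary values of `θ` exist a.e. and are contractions. -/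
def HasContractiveBoundaryValues (θ : ℂ → (U →L[ℂ] Y)) : Prop :=
  ∀ᵐ t ∂(volume : Measure ℝ), ∃ T : U →L[ℂ] Y, RadialLimitAt θ t T ∧ ‖T‖ ≤ 1

/-- `θ` has isometric boundary values a.e. -/
def HasIsometricBoundaryValues (θ : ℂ → (U →L[ℂ] Y)) : Prop :=
  ∀ᵐ t ∂(volume : Measure ℝ), ∃ T : U →L[ℂ] Y, RadialLimitAt θ t T ∧
    ContinuousLinearMap.adjoint T ∘L T = 1

/-- `θ` has co-isometric boundary values a.e. -/
def HasCoisometricBoundaryValues (θ : ℂ → (U →L[ℂ] Y)) : Prop :=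
  ∀ᵐ t ∂(volume : Measure ℝ), ∃ T : U →L[ℂ] Y, RadialLimitAt θ t T ∧
    T ∘L ContinuousLinearMap.adjoint T = 1

/-- `θ` has unitary boundary values a.e. -/
def HasUnitaryBoundaryValues (θ : ℂ → (U →L[ℂ] Y)) : Prop :=
  ∀ᵐ t ∂(volume : Measure ℝ), ∃ T : U →L[ℂ] Y, RadialLimitAt θ t T ∧
    ContinuousLinearMap.adjoint T ∘L T = 1 ∧ T ∘L ContinuousLinearMap.adjoint T = 1

/-- the right defect function of `θ` vanishes identically: the only Schur-class function
`φ` with `φ(ζ)*φ(ζ) ≤ I − θ(ζ)*θ(ζ)` a.e. on the circle is `φ ≡ 0`. -/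
def RightDefectZero (θ : ℂ → (U →L[ℂ] Y)) : Prop :=
  ∀ (K : Type) (_ : NormedAddCommGroup K) (_ : InnerProductSpace ℂ K) (_ : CompleteSpace K)
    (φ : ℂ → (U →L[ℂ] K)), MemSchurClassZero φ →
    (∀ᵐ t ∂(volume : Measure ℝ), ∃ (T : U →L[ℂ] Y) (F : U →L[ℂ] K),
      RadialLimitAt θ t T ∧ RadialLimitAt φ t F ∧
        ∀ u : U, ‖F u‖ ^ 2 ≤ ‖u‖ ^ 2 - ‖T u‖ ^ 2) →
    ∀ z ∈ ball (0 : ℂ) 1, φ z = 0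

/-- the left defect function of `θ` vanishes identically: the only Schur-class function
`ψ` with `ψ(ζ)ψ(ζ)* ≤ I − θ(ζ)θ(ζ)*` a.e. on the circle is `ψ ≡ 0`. -/
def LeftDefectZero (θ : ℂ → (U →L[ℂ] Y)) : Prop :=
  ∀ (K : Type) (_ : NormedAddCommGroup K) (_ : InnerProductSpace ℂ K) (_ : CompleteSpace K)
    (ψ : ℂ → (K →L[ℂ] Y)), MemSchurClassZero ψ →
    (∀ᵐ t ∂(volume : Measure ℝ), ∃ (T : U →L[ℂ] Y) (P : K →L[ℂ] Y),
      RadialLimitAt θ t T ∧ RadialLimitAt ψ t P ∧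
        ∀ y : Y, ‖ContinuousLinearMap.adjoint P y‖ ^ 2
          ≤ ‖y‖ ^ 2 - ‖ContinuousLinearMap.adjoint T y‖ ^ 2) →
    ∀ z ∈ ball (0 : ℂ) 1, ψ z = 0

end Boundary

section RKPS

variable {U Y : Type*} [NormedAddCommGroup U] [InnerProductSpace ℂ U] [CompleteSpace U]
  [NormedAddCommGroup Y] [InnerProductSpace ℂ Y] [CompleteSpace Y]
  {H : Type*} [NormedAddCommGroup H] [InnerProductSpace ℂ H] [CompleteSpace H]

/-- `(H, JH, ev)` is a model of the reproducing kernel Pontryagin space `H(S)` of the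
Schur kernel of `S` on `Ω`: `H` is a Pontryagin space of negative index `κ` whose elements
are (via `ev`) `Y`-valued functions on `Ω`, containing the kernel functions and having the
reproducing property `[h, K_S(w,·)f] = ⟨h(w), f⟩`. -/
structure IsRKPS (S : ℂ → (U →L[ℂ] Y)) (Ω : Set ℂ) (κ : ℕ)
    (JH : H →L[ℂ] H) (ev : H →ₗ[ℂ] (ℂ → Y)) : Prop where
  fund : IsFundamentalSymmetry JH κ
  repro : ∀ w ∈ Ω, ∀ f : Y, ∃ k : H, (∀ z ∈ Ω, ev k z = schurKernel S w z f) ∧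
      ∀ h : H, ⟪JH h, k⟫ = ⟪ev h w, f⟫
  sep : ∀ h : H, (∀ z ∈ Ω, ev h z = 0) → h = 0

/-- `S^#(z) := (S(conj z))*`. -/
def sharp (S : ℂ → (U →L[ℂ] Y)) : ℂ → (Y →L[ℂ] U) :=
  fun z => ContinuousLinearMap.adjoint (S (starRingEnd ℂ z))

end RKPS


section PBasics

set_option linter.unusedSectionVars false

variable {X : Type*} [NormedAddCommGroup X] [InnerProductSpace ℂ X] [CompleteSpace X]
  {X' : Type*} [NormedAddCommGroup X'] [InnerProductSpace ℂ X'] [CompleteSpace X']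

/-- the negative eigenspace -/
abbrev negSp (J : X →L[ℂ] X) : Submodule ℂ X :=
  LinearMap.ker ((J : X →ₗ[ℂ] X) + LinearMap.id)

/-- symmetries -/
structure IsSym (J : X →L[ℂ] X) : Prop where
  sa : ∀ x y, ⟪J x, y⟫ = ⟪x, J y⟫
  sq : ∀ x, J (J x) = x

theorem IsFundamentalSymmetry.isSym {J : X →L[ℂ] X} {κ : ℕ} (h : IsFundamentalSymmetry J κ) :
    IsSym J where
  sa := fun x y => by
    have := h.1
    rw [← ContinuousLinearMap.adjoint_inner_right, ← ContinuousLinearMap.star_eq_adjoint, this.star_eq]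
  sq := fun x => by
    have := DFunLike.congr_fun h.2.1 x
    simpa using this

theorem mem_negSp {J : X →L[ℂ] X} {x : X} : x ∈ negSp J ↔ J x = -x := by
  simp [negSp, LinearMap.mem_ker, add_eq_zero_iff_eq_neg]

theorem IsSym.norm {J : X →L[ℂ] X} (h : IsSym J) (x : X) : ‖J x‖ = ‖x‖ := by
  have : ‖J x‖ ^ 2 = ‖x‖ ^ 2 := by
    rw [← inner_self_eq_norm_sq (𝕜 := ℂ), ← inner_self_eq_norm_sq (𝕜 := ℂ), h.sa, h.sq]
  exact (sq_eq_sq₀ (norm_nonneg _) (norm_nonneg _)).1 this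

theorem IsSym.re_le {J : X →L[ℂ] X} (h : IsSym J) (x y : X) : ‖⟪J x, y⟫‖ ≤ ‖x‖ * ‖y‖ := by
  have := norm_inner_le_norm (𝕜 := ℂ) (J x) y
  rwa [h.norm] at this

/-- projection on the negative part -/
def negProj (J : X →L[ℂ] X) (hJ : IsSym J) : X →ₗ[ℂ] negSp J :=
  LinearMap.codRestrict (negSp J) ((1 / 2 : ℂ) • (LinearMap.id - (J : X →ₗ[ℂ] X))) (fun x => by
    rw [mem_negSp]
    simp [hJ.sq, ← smul_neg])

theorem negProj_coe {J : X →L[ℂ] X} (hJ : IsSym J) (x : X) :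
    (negProj J hJ x : X) = (1 / 2 : ℂ) • (x - J x) := rfl

theorem norm_sq_eq {J : X →L[ℂ] X} (hJ : IsSym J) (x : X) :
    ‖x‖ ^ 2 = (⟪J x, x⟫).re + 2 * ‖negProj J hJ x‖ ^ 2 := by
  rw [Submodule.coe_norm, negProj_coe, norm_smul, mul_pow, ← inner_self_eq_norm_sq (𝕜 := ℂ) (x - J x)]
  rw [inner_sub_left, inner_sub_right, inner_sub_right, ← hJ.sa x x, ← hJ.sa (J x) x, hJ.sq]
  simp only [map_sub, inner_self_eq_norm_sq]
  simp
  have h := inner_self_eq_norm_sq (𝕜 := ℂ) x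
  simp only [RCLike.re_to_complex] at h
  nlinarith [h]

theorem inner_negProj {J : X →L[ℂ] X} (hJ : IsSym J) (x : X) :
    (⟪J x, (negProj J hJ x : X)⟫).re = - ‖negProj J hJ x‖ ^ 2 := by
  have h1 := norm_sq_eq hJ x
  rw [negProj_coe, inner_smul_right, inner_sub_right]
  have h2 : ⟪J x, J x⟫ = ((‖x‖ ^ 2 : ℝ) : ℂ) := by
    rw [inner_self_eq_norm_sq_to_K, hJ.norm]; simp
  rw [h2]
  have : ((1 / 2 : ℂ) * (⟪J x, x⟫ - ((‖x‖ ^ 2 : ℝ) : ℂ))).re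
      = 1 / 2 * ((⟪J x, x⟫).re - ‖x‖ ^ 2) := by
    rw [show (1 / 2 : ℂ) = ((1 / 2 : ℝ) : ℂ) by push_cast; rfl, Complex.re_ofReal_mul, Complex.sub_re,
      Complex.ofReal_re]
  rw [this]; linarith

theorem exists_approx {J : X →L[ℂ] X} [FiniteDimensional ℂ (negSp J)]
    {P : Type*} [AddCommGroup P] [Module ℂ P] (a : P →ₗ[ℂ] X) (ha : DenseRange a) :
    ∃ φ : negSp J →ₗ[ℂ] P, ∀ e : negSp J, ‖a (φ e) - e‖ ≤ (1 / 4) * ‖e‖ := by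
  let ob := stdOrthonormalBasis ℂ (negSp J)
  set n := Module.finrank ℂ (negSp J)
  have hε : (0 : ℝ) < 1 / (4 * (n + 1)) := by positivity
  have : ∀ i, ∃ p : P, ‖a p - (ob i : X)‖ < 1 / (4 * (n + 1)) := fun i => by
    obtain ⟨p, hp⟩ := ha.exists_dist_lt (ob i : X) hε
    exact ⟨p, by rwa [dist_comm, dist_eq_norm] at hp⟩
  choose p hp using this
  refine ⟨ob.toBasis.constr ℂ p, fun e => ?_⟩
  have h1 : a (ob.toBasis.constr ℂ p e) - (e : X) = ∑ i, ob.repr e i • (a (p i) - (ob i : X)) := by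
    have h2 : (e : X) = ∑ i, ob.repr e i • (ob i : X) := by
      conv_lhs => rw [← ob.sum_repr e]
      simp
    rw [Module.Basis.constr_apply_fintype, map_sum]
    conv_lhs => rw [h2]
    rw [← Finset.sum_sub_distrib]
    refine Finset.sum_congr rfl fun i _ => ?_
    simp [smul_sub]
  rw [h1]
  calc ‖∑ i, ob.repr e i • (a (p i) - (ob i : X))‖
      ≤ ∑ i : Fin n, ‖e‖ * (1 / (4 * (n + 1))) := by
        refine norm_sum_le_of_le _ fun i _ => ?_
        rw [norm_smul]
        have : ‖ob.repr e i‖ ≤ ‖e‖ := by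
          rw [ob.repr_apply_apply]
          have := norm_inner_le_norm (𝕜 := ℂ) (ob i) e
          rwa [ob.orthonormal.1 i, one_mul] at this
        gcongr
        exact (hp i).le
    _ ≤ (1 / 4) * ‖e‖ := by
        rw [Finset.sum_const, Finset.card_univ, Fintype.card_fin, nsmul_eq_mul]
        have : (n : ℝ) * (1 / (4 * (n + 1))) ≤ 1 / 4 := by
          rw [mul_one_div, div_le_div_iff₀ (by positivity) (by norm_num)]
          linarith
        nlinarith [norm_nonneg e]

theorem approx_neg {J : X →L[ℂ] X} (hJ : IsSym J) {e : negSp J} {y : X}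
    (h : ‖y - e‖ ≤ (1 / 4) * ‖e‖) : (⟪J y, y⟫).re ≤ -(1 / 4) * ‖e‖ ^ 2 := by
  have h1 : y = e + (y - e) := by abel
  set δ := y - e
  rw [h1, map_add, inner_add_left, inner_add_right, inner_add_right]
  have he : J (e : X) = -(e : X) := mem_negSp.1 e.2
  have h2 : (⟪J (e : X), (e : X)⟫).re = - ‖e‖ ^ 2 := by
    rw [he, inner_neg_left, Complex.neg_re]
    have := inner_self_eq_norm_sq (𝕜 := ℂ) (e : X)
    simp only [RCLike.re_to_complex] at this
    rw [this, Submodule.coe_norm]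
  have b1 := (Complex.re_le_norm ⟪J (e : X), δ⟫).trans (hJ.re_le _ _)
  have b2 := (Complex.re_le_norm ⟪J δ, (e : X)⟫).trans (hJ.re_le _ _)
  have b3 := (Complex.re_le_norm ⟪J δ, δ⟫).trans (hJ.re_le _ _)
  rw [← Submodule.coe_norm] at b1 b2
  simp only [Complex.add_re, h2]
  have := norm_nonneg e
  have := norm_nonneg δ
  nlinarith

theorem negProj_injOn {J : X →L[ℂ] X} (hJ : IsSym J) {x : X} (h0 : negProj J hJ x = 0) :
    ‖x‖ ^ 2 = (⟪J x, x⟫).re := by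
  rw [norm_sq_eq hJ x, h0]; simp

/-- index comparison and boundedness for contractive relations. -/
theorem index_le {J : X →L[ℂ] X} (hJ : IsSym J) [FiniteDimensional ℂ (negSp J)]
    {J' : X' →L[ℂ] X'} (hJ' : IsSym J') [FiniteDimensional ℂ (negSp J')]
    {P : Type*} [AddCommGroup P] [Module ℂ P] (a : P →ₗ[ℂ] X) (b : P →ₗ[ℂ] X')
    (ha : DenseRange a) (hab : ∀ p, (⟪J' (b p), b p⟫).re ≤ (⟪J (a p), a p⟫).re) :
    ∃ φ : negSp J →ₗ[ℂ] P, (∀ e : negSp J, ‖a (φ e) - e‖ ≤ (1 / 4) * ‖e‖) ∧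
      Function.Injective ((negProj J' hJ') ∘ₗ b ∘ₗ φ) := by
  obtain ⟨φ, hφ⟩ := exists_approx (J := J) a ha
  refine ⟨φ, hφ, ?_⟩
  rw [injective_iff_map_eq_zero]
  intro e he
  have h1 := negProj_injOn hJ' (x := b (φ e)) he
  have h2 := approx_neg hJ (hφ e)
  have h3 := hab (φ e)
  have : ‖e‖ ^ 2 ≤ 0 := by nlinarith [sq_nonneg ‖b (φ e)‖]
  have : ‖e‖ = 0 := by nlinarith [norm_nonneg e]
  exact norm_eq_zero.1 this

theorem finrank_le {J : X →L[ℂ] X} (hJ : IsSym J) [FiniteDimensional ℂ (negSp J)]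
    {J' : X' →L[ℂ] X'} (hJ' : IsSym J') [FiniteDimensional ℂ (negSp J')]
    {P : Type*} [AddCommGroup P] [Module ℂ P] (a : P →ₗ[ℂ] X) (b : P →ₗ[ℂ] X')
    (ha : DenseRange a) (hab : ∀ p, (⟪J' (b p), b p⟫).re ≤ (⟪J (a p), a p⟫).re) :
    Module.finrank ℂ (negSp J) ≤ Module.finrank ℂ (negSp J') := by
  obtain ⟨φ, _, h⟩ := index_le hJ hJ' a b ha hab
  exact LinearMap.finrank_le_finrank_of_injective h

theorem exists_bounded {J : X →L[ℂ] X} (hJ : IsSym J) [FiniteDimensional ℂ (negSp J)]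
    {J' : X' →L[ℂ] X'} (hJ' : IsSym J') [FiniteDimensional ℂ (negSp J')]
    (hfin : Module.finrank ℂ (negSp J') ≤ Module.finrank ℂ (negSp J))
    {P : Type*} [AddCommGroup P] [Module ℂ P] (a : P →ₗ[ℂ] X) (b : P →ₗ[ℂ] X')
    (ha : DenseRange a) (hab : ∀ p, (⟪J' (b p), b p⟫).re ≤ (⟪J (a p), a p⟫).re) :
    ∃ T : X →L[ℂ] X', ∀ p, T (a p) = b p := by
  obtain ⟨φ, hφ, hinj⟩ := index_le hJ hJ' a b ha hab
  have hfe := le_antisymm (LinearMap.finrank_le_finrank_of_injective hinj) hfin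
  have hsurj := (LinearMap.injective_iff_surjective_of_finrank_eq_finrank hfe).1 hinj
  let β : negSp J →L[ℂ] X' := LinearMap.toContinuousLinearMap (b ∘ₗ φ)
  have hβ : ∀ e, b (φ e) = β e := fun e => rfl
  refine ⟨b.extendOfNorm a, LinearMap.extendOfNorm_eq ha ⟨4 + 20 * ‖β‖, fun p => ?_⟩⟩
  obtain ⟨e, he⟩ := hsurj (negProj J' hJ' (-(b p)))
  have h0 : negProj J' hJ' (b (p + φ e)) = 0 := by
    have : negProj J' hJ' (b (φ e)) = negProj J' hJ' (-(b p)) := he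
    rw [map_add, map_add, this, map_neg]; simp
  have h1 := negProj_injOn hJ' h0
  have h2 := hab (p + φ e)
  have h3 := approx_neg hJ (hφ e)
  have h4 : (⟪J (a (p + φ e)), a (p + φ e)⟫).re ≤
      ‖a p‖ ^ 2 + 2 * (‖a p‖ * ‖a (φ e)‖) - (1 / 4) * ‖e‖ ^ 2 := by
    rw [map_add, map_add, inner_add_left, inner_add_right, inner_add_right]
    have b1 := (Complex.re_le_norm ⟪J (a p), a p⟫).trans (hJ.re_le _ _)
    have b2 := (Complex.re_le_norm ⟪J (a p), a (φ e)⟫).trans (hJ.re_le _ _)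
    have b3 := (Complex.re_le_norm ⟪J (a (φ e)), a p⟫).trans (hJ.re_le _ _)
    simp only [Complex.add_re]
    nlinarith
  have h5 : ‖a (φ e)‖ ≤ (5 / 4) * ‖e‖ := by
    have : a (φ e) = (a (φ e) - e) + e := by abel
    rw [this]
    refine (norm_add_le _ _).trans ?_
    have := hφ e
    rw [← Submodule.coe_norm]
    linarith
  have n1 := norm_nonneg (a p)
  have n2 := norm_nonneg e
  have h6 : 0 ≤ ‖a p‖ ^ 2 + (5 / 2) * (‖a p‖ * ‖e‖) - (1 / 4) * ‖e‖ ^ 2 := by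
    have : ‖a p‖ * ‖a (φ e)‖ ≤ ‖a p‖ * ((5 / 4) * ‖e‖) := by gcongr
    nlinarith [sq_nonneg ‖b (p + φ e)‖]
  have h7 : ‖e‖ ≤ 20 * ‖a p‖ := by
    by_contra hc
    push Not at hc
    nlinarith
  have h8 : ‖b (p + φ e)‖ ^ 2 ≤ (4 * ‖a p‖) ^ 2 := by
    have h81 : ‖b (p + φ e)‖ ^ 2 ≤ ‖a p‖ ^ 2 + (5 / 2) * (‖a p‖ * ‖e‖) - (1 / 4) * ‖e‖ ^ 2 := by
      have : ‖a p‖ * ‖a (φ e)‖ ≤ ‖a p‖ * ((5 / 4) * ‖e‖) := by gcongr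
      nlinarith
    nlinarith [sq_nonneg (‖e‖ - 5 * ‖a p‖)]
  have h9 : ‖b (p + φ e)‖ ≤ 4 * ‖a p‖ := by
    exact (sq_le_sq₀ (norm_nonneg _) (by positivity)).1 h8
  have h10 : b p = b (p + φ e) - β e := by rw [map_add, hβ]; abel
  rw [h10]
  refine (norm_sub_le _ _).trans ?_
  have h11 := β.le_opNorm e
  have : ‖β‖ * ‖e‖ ≤ ‖β‖ * (20 * ‖a p‖) := by gcongr
  linarith

/-- a norm estimate via finitely many functionals -/
theorem exists_norm_est {J : X →L[ℂ] X} (hJ : IsSym J) [FiniteDimensional ℂ (negSp J)]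
    {P : Type*} [AddCommGroup P] [Module ℂ P] (a : P →ₗ[ℂ] X) (ha : DenseRange a) :
    ∃ (n : ℕ) (p : Fin n → P), ∀ x : X,
      ‖x‖ ^ 2 ≤ 2 * |(⟪J x, x⟫).re| + 8 * (∑ i, ‖⟪J x, a (p i)⟫‖) ^ 2 := by
  obtain ⟨φ, hφ⟩ := exists_approx (J := J) a ha
  let ob := stdOrthonormalBasis ℂ (negSp J)
  refine ⟨_, fun i => φ (ob i), fun x => ?_⟩
  set q := negProj J hJ x with hq
  set s := ∑ i, ‖⟪J x, a (φ (ob i))⟫‖ with hs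
  have h1 := norm_sq_eq hJ x
  have h2 := inner_negProj hJ x
  rw [← hq] at h1 h2
  have h3 : ‖⟪J x, a (φ q)⟫‖ ≤ ‖q‖ * s := by
    have : a (φ q) = ∑ i, ob.repr q i • a (φ (ob i)) := by
      conv_lhs => rw [← ob.sum_repr q]
      simp
    rw [this, inner_sum, hs, Finset.mul_sum]
    refine norm_sum_le_of_le _ fun i _ => ?_
    rw [inner_smul_right, norm_mul]
    have : ‖ob.repr q i‖ ≤ ‖q‖ := by
      rw [ob.repr_apply_apply]
      have := norm_inner_le_norm (𝕜 := ℂ) (ob i) q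
      rwa [ob.orthonormal.1 i, one_mul] at this
    gcongr
  have h4 : ‖q‖ ^ 2 ≤ ‖q‖ * s + ‖x‖ * ((1 / 4) * ‖q‖) := by
    have e1 : (q : X) = a (φ q) - (a (φ q) - q) := by abel
    have e2 : (⟪J x, (q : X)⟫).re = (⟪J x, a (φ q)⟫).re - (⟪J x, a (φ q) - q⟫).re := by
      conv_lhs => rw [e1, inner_sub_right, Complex.sub_re]
    have b1 := (Complex.abs_re_le_norm ⟪J x, a (φ q)⟫).trans h3
    have b2 := (Complex.abs_re_le_norm ⟪J x, a (φ q) - q⟫).trans (hJ.re_le _ _)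
    have b3 : ‖x‖ * ‖a (φ q) - q‖ ≤ ‖x‖ * ((1 / 4) * ‖q‖) := by
      gcongr
      exact hφ q
    have := abs_le.1 b1
    have := abs_le.1 b2
    linarith
  have n1 := norm_nonneg q
  have n2 := norm_nonneg x
  have hs0 : 0 ≤ s := Finset.sum_nonneg fun i _ => norm_nonneg _
  have h5 : ‖q‖ ≤ s + (1 / 4) * ‖x‖ := by
    rcases eq_or_lt_of_le n1 with h | h
    · rw [← h]; positivity
    · by_contra hc
      push Not at hc
      nlinarith
  have h6 := le_abs_self (⟪J x, x⟫).re
  have h7 : ‖q‖ ^ 2 ≤ (s + (1 / 4) * ‖x‖) ^ 2 := by gcongr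
  nlinarith [sq_nonneg (s - (1 / 4) * ‖x‖)]

theorem negSp_finite_of_nonneg {J : X →L[ℂ] X} 
    {P : Type*} (a : P → X) (ha : DenseRange a) (h : ∀ p, 0 ≤ (⟪J (a p), a p⟫).re) :
    FiniteDimensional ℂ (negSp J) := by
  have hall : ∀ x, 0 ≤ (⟪J x, x⟫).re := by
    intro x
    refine ha.induction_on x ?_ h
    exact isClosed_le continuous_const (by fun_prop)
  have : negSp J = ⊥ := by
    rw [Submodule.eq_bot_iff]
    intro e he
    have h1 := hall e
    rw [mem_negSp.1 he, inner_neg_left, Complex.neg_re] at h1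
    have := inner_self_eq_norm_sq (𝕜 := ℂ) e
    simp only [RCLike.re_to_complex] at this
    rw [this] at h1
    have : ‖e‖ = 0 := by nlinarith [norm_nonneg e]
    exact norm_eq_zero.1 this
  rw [this]; infer_instance

theorem isFinite_of_pos {J : X →L[ℂ] X} {κ : ℕ} (h : IsFundamentalSymmetry J κ) (hκ : κ ≠ 0) :
    FiniteDimensional ℂ (negSp J) :=
  Module.finite_of_finrank_pos (by have := h.2.2; rw [negSp, this]; omega)

theorem IsSym.eq_zero {J : X →L[ℂ] X} (hJ : IsSym J) {x : X} (h : ∀ y, ⟪J x, y⟫ = 0) : x = 0 := by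
  have := h (J x)
  rw [inner_self_eq_zero] at this
  rw [← hJ.sq x, this, map_zero]

end PBasics


section LemmaA

set_option linter.unusedSectionVars false

theorem exists_contraction {P E F : Type*} [AddCommGroup P] [Module ℂ P]
    [NormedAddCommGroup E] [InnerProductSpace ℂ E] [CompleteSpace E]
    [NormedAddCommGroup F] [InnerProductSpace ℂ F] [CompleteSpace F]
    (a : P →ₗ[ℂ] E) (b : P →ₗ[ℂ] F) (h : ∀ p, ‖b p‖ ≤ ‖a p‖) :
    ∃ W : E →L[ℂ] F, (∀ x, ‖W x‖ ≤ ‖x‖) ∧ ∀ p, W (a p) = b p := by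
  let M : Submodule ℂ E := (LinearMap.range a).topologicalClosure
  have : CompleteSpace M := (Submodule.isClosed_topologicalClosure _).completeSpace_coe
  have hm : ∀ p, a p ∈ M := fun p => Submodule.le_topologicalClosure _ ⟨p, rfl⟩
  let a' : P →ₗ[ℂ] M := a.codRestrict M hm
  have hd : DenseRange a' := by
    intro x
    rw [closure_subtype]
    have h1 : (Set.image Subtype.val (Set.range a')) = (LinearMap.range a : Set E) := by
      ext y; constructor
      · rintro ⟨_, ⟨p, rfl⟩, rfl⟩; exact ⟨p, rfl⟩
      · rintro ⟨p, rfl⟩; exact ⟨a' p, ⟨p, rfl⟩, rfl⟩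
    rw [h1]
    exact x.2
  have hn : ∀ p, ‖b p‖ ≤ 1 * ‖a' p‖ := fun p => by simpa [a'] using h p
  refine ⟨(b.extendOfNorm a') ∘L M.orthogonalProjectionOnto, fun x => ?_, fun p => ?_⟩
  · have h1 := LinearMap.norm_extendOfNorm_apply_le hd 1 hn (M.orthogonalProjectionOnto x)
    have h2 := M.norm_orthogonalProjectionOnto_apply_le x
    simp only [ContinuousLinearMap.comp_apply]
    linarith
  · have h1 : M.orthogonalProjectionOnto (a p) = a' p := by
      have := M.orthogonalProjectionOnto_mem_subspace_eq_self ⟨a p, hm p⟩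
      exact this
    simp only [ContinuousLinearMap.comp_apply, h1]
    exact LinearMap.extendOfNorm_eq hd ⟨1, hn⟩ p

variable {ι : Type*} [Fintype ι]
  {U Y : Type*} [NormedAddCommGroup U] [InnerProductSpace ℂ U] [CompleteSpace U]
  [NormedAddCommGroup Y] [InnerProductSpace ℂ Y] [CompleteSpace Y]

theorem one_sub_ne {w z : ℂ} (hw : ‖w‖ < 1) (hz : ‖z‖ < 1) : 1 - w * z ≠ 0 := by
  intro h
  have h1 : w * z = 1 := (sub_eq_zero.mp h).symm
  have h2 : ‖w * z‖ = 1 := by rw [h1]; simp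
  rw [norm_mul] at h2
  nlinarith [norm_nonneg w, norm_nonneg z]

theorem sum_norm_sq {ι E : Type*} [Fintype ι] [NormedAddCommGroup E] [InnerProductSpace ℂ E] (v : ι → E) :
    ‖∑ i, v i‖ ^ 2 = (∑ i, ∑ j, ⟪v i, v j⟫).re := by
  rw [← inner_self_eq_norm_sq (𝕜 := ℂ), sum_inner]
  simp_rw [inner_sum]; rfl

theorem sum_single_apply {ι Y F : Type*} [Fintype ι] [DecidableEq ι] [AddCommGroup Y] [AddCommGroup F]
    (φ : ι → Y → F) (h0 : ∀ i, φ i 0 = 0) (j : ι) (y : Y) :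
    ∑ i, φ i ((Pi.single j y : ι → Y) i) = φ j y := by
  rw [Finset.sum_eq_single j]
  · simp
  · intro i _ hi; simp [Pi.single_eq_of_ne hi, h0]
  · simp

theorem toLp_sum_pair {ι E F : Type*} [Fintype ι] [NormedAddCommGroup E] [NormedAddCommGroup F]
    (x : ι → E) (y : ι → F) :
    (WithLp.toLp 2 (∑ j, x j, ∑ j, y j) : WithLp 2 (E × F)) = ∑ j, WithLp.toLp 2 (x j, y j) := by
  rw [← WithLp.toLp_sum]
  congr 1
  ext <;> simp [Prod.fst_sum, Prod.snd_sum]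

theorem dual_pos_aux {H : Type*} [NormedAddCommGroup H] [InnerProductSpace ℂ H] [CompleteSpace H]
    (w : ι → ℂ) (hw : ∀ i, ‖w i‖ < 1) (S : ι → (U →L[ℂ] Y)) (k : ι → Y →L[ℂ] H)
    (hk : ∀ i j v v', ⟪k i v, k j v'⟫ = (1 - w i * conj (w j))⁻¹ *
      (⟪v, v'⟫ - ⟪adjoint (S i) v, adjoint (S j) v'⟫)) (u : ι → U) :
    0 ≤ (∑ i, ∑ j, (1 - conj (w i) * w j)⁻¹ *
      (⟪u i, u j⟫ - ⟪S i (u i), S j (u j)⟫)).re := by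
  have hne : ∀ i j, 1 - w i * conj (w j) ≠ 0 := fun i j => one_sub_ne (hw i) (by simpa using hw j)
  have hne' : ∀ i j, 1 - conj (w i) * w j ≠ 0 := fun i j => one_sub_ne (by simpa using hw i) (hw j)
  let a1 : (ι → Y) →ₗ[ℂ] H := ∑ j, (conj (w j)) • ((k j : Y →ₗ[ℂ] H) ∘ₗ LinearMap.proj j)
  let a2 : (ι → Y) →ₗ[ℂ] Y := ∑ j, LinearMap.proj j
  let b1 : (ι → Y) →ₗ[ℂ] H := ∑ j, (k j : Y →ₗ[ℂ] H) ∘ₗ LinearMap.proj j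
  let b2 : (ι → Y) →ₗ[ℂ] U := ∑ j, (adjoint (S j) : Y →ₗ[ℂ] U) ∘ₗ LinearMap.proj j
  let a : (ι → Y) →ₗ[ℂ] WithLp 2 (H × Y) :=
    (WithLp.linearEquiv 2 ℂ (H × Y)).symm.toLinearMap ∘ₗ (a1.prod a2)
  let b : (ι → Y) →ₗ[ℂ] WithLp 2 (H × U) :=
    (WithLp.linearEquiv 2 ℂ (H × U)).symm.toLinearMap ∘ₗ (b1.prod b2)
  have ha : ∀ f, a f = WithLp.toLp 2 (∑ j, conj (w j) • k j (f j), ∑ j, f j) := by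
    intro f; simp [a, a1, a2, LinearMap.sum_apply]
  have hb : ∀ f, b f = WithLp.toLp 2 (∑ j, k j (f j), ∑ j, adjoint (S j) (f j)) := by
    intro f; simp [b, b1, b2, LinearMap.sum_apply]
  have hab : ∀ f, ‖b f‖ ≤ ‖a f‖ := by
    intro f
    refine le_of_eq ?_
    have : ‖b f‖ ^ 2 = ‖a f‖ ^ 2 := by
      rw [ha, hb, WithLp.prod_norm_sq_eq_of_L2, WithLp.prod_norm_sq_eq_of_L2]
      change ‖∑ j, k j (f j)‖ ^ 2 + ‖∑ j, adjoint (S j) (f j)‖ ^ 2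
        = ‖∑ j, conj (w j) • k j (f j)‖ ^ 2 + ‖∑ j, f j‖ ^ 2
      simp only [sum_norm_sq]
      rw [← Complex.add_re, ← Complex.add_re, ← Finset.sum_add_distrib, ← Finset.sum_add_distrib]
      congr 1
      apply Finset.sum_congr rfl; intro i _
      rw [← Finset.sum_add_distrib, ← Finset.sum_add_distrib]
      apply Finset.sum_congr rfl; intro j _
      rw [inner_smul_left, inner_smul_right, hk, Complex.conj_conj]
      have := hne i j
      field_simp
      ring
    exact (sq_eq_sq₀ (norm_nonneg _) (norm_nonneg _)).1 this
  obtain ⟨W, hW1, hW2⟩ := exists_contraction a b hab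
  let T : WithLp 2 (H × U) →L[ℂ] WithLp 2 (H × Y) := adjoint W
  have hT : ∀ x, ‖T x‖ ≤ ‖x‖ := by
    intro x
    have h1 : ‖W‖ ≤ 1 := W.opNorm_le_bound zero_le_one (by simpa using hW1)
    have h2 : ‖T‖ ≤ 1 := (LinearIsometryEquiv.norm_map adjoint W).trans_le h1
    calc ‖T x‖ ≤ ‖T‖ * ‖x‖ := T.le_opNorm x
      _ ≤ 1 * ‖x‖ := by gcongr
      _ = ‖x‖ := one_mul _
  have hT2 : ∀ x j y, ⟪T x, WithLp.toLp 2 (conj (w j) • k j y, y)⟫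
      = ⟪x, WithLp.toLp 2 (k j y, adjoint (S j) y)⟫ := by
    intro x j y
    classical
    have := hW2 (Pi.single j y)
    rw [ha, hb] at this
    rw [sum_single_apply (fun i v => conj (w i) • k i v) (by simp) j y,
      sum_single_apply (fun _ v => v) (by simp) j y,
      sum_single_apply (fun i v => k i v) (by simp) j y,
      sum_single_apply (fun i v => adjoint (S i) v) (by simp) j y] at this
    rw [show T = adjoint W from rfl, adjoint_inner_left, this]
  have hg : ∀ j, ∃ g : H, T (WithLp.toLp 2 (w j • g, u j)) = WithLp.toLp 2 (g, S j (u j)) := by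
    intro j
    have hc : ContractingWith ⟨‖w j‖, norm_nonneg _⟩
        (fun g : H => (T (WithLp.toLp 2 (w j • g, u j))).fst) := by
      refine ⟨by exact_mod_cast hw j, LipschitzWith.of_dist_le_mul fun x y => ?_⟩
      rw [dist_eq_norm, dist_eq_norm, ← WithLp.sub_fst, ← map_sub]
      refine (WithLp.norm_fst_le _ _).trans ((hT _).trans ?_)
      rw [← WithLp.toLp_sub, Prod.mk_sub_mk, sub_self, ← smul_sub]
      have h2 : ‖(WithLp.toLp 2 (w j • (x - y), (0:U)) : WithLp 2 (H × U))‖ ^ 2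
          = (‖w j‖ * ‖x - y‖) ^ 2 := by
        rw [WithLp.prod_norm_sq_eq_of_L2]; simp [norm_smul]
      exact le_of_eq ((sq_eq_sq₀ (norm_nonneg _) (mul_nonneg (norm_nonneg _) (norm_nonneg _))).1 h2)
    refine ⟨hc.fixedPoint, ?_⟩
    have hfix := hc.fixedPoint_isFixedPt
    set g := hc.fixedPoint with hgdef
    have h1 : (T (WithLp.toLp 2 (w j • g, u j))).fst = g := hfix
    have h2 : (T (WithLp.toLp 2 (w j • g, u j))).snd = S j (u j) := by
      refine ext_inner_right ℂ fun y => ?_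
      have := hT2 (WithLp.toLp 2 (w j • g, u j)) j y
      rw [WithLp.prod_inner_apply, WithLp.prod_inner_apply] at this
      simp only [inner_smul_left, inner_smul_right, adjoint_inner_right] at this
      change _ * inner ℂ ((T (WithLp.toLp 2 (w j • g, u j))).fst) _ + inner ℂ ((T (WithLp.toLp 2 (w j • g, u j))).snd) _ = _ at this
      rw [h1] at this
      exact add_left_cancel this
    have h3 : ∀ x : WithLp 2 (H × Y), x = WithLp.toLp 2 (x.fst, x.snd) := fun x => rfl
    rw [h3 (T _), h1, h2]
  choose g hg using hg
  let N : ℕ → ℝ := fun m => ‖∑ j, w j ^ m • g j‖ ^ 2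
  let e : ℕ → ℂ := fun m => ∑ i, ∑ j, (conj (w i) * w j) ^ m *
      (⟪u i, u j⟫ - ⟪S i (u i), S j (u j)⟫)
  have hstep : ∀ m, N m - N (m + 1) ≤ (e m).re := by
    intro m
    have h1 := hT (WithLp.toLp 2 (∑ j, w j ^ (m+1) • g j, ∑ j, w j ^ m • u j))
    have h2 : T (WithLp.toLp 2 (∑ j, w j ^ (m+1) • g j, ∑ j, w j ^ m • u j))
        = WithLp.toLp 2 (∑ j, w j ^ m • g j, ∑ j, w j ^ m • S j (u j)) := by
      rw [toLp_sum_pair, toLp_sum_pair, map_sum]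
      apply Finset.sum_congr rfl; intro j _
      have := congrArg (fun x => w j ^ m • x) (hg j)
      simp only [← map_smul, ← WithLp.toLp_smul, Prod.smul_mk, smul_smul, ← pow_succ] at this
      rw [this, map_smul]
    rw [h2] at h1
    have h3 := pow_le_pow_left₀ (norm_nonneg _) h1 2
    rw [WithLp.prod_norm_sq_eq_of_L2, WithLp.prod_norm_sq_eq_of_L2] at h3
    have h4 : (e m).re = ‖∑ j, w j ^ m • u j‖ ^ 2 - ‖∑ j, w j ^ m • S j (u j)‖ ^ 2 := by
      rw [sum_norm_sq, sum_norm_sq, ← Complex.sub_re, ← Finset.sum_sub_distrib]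
      congr 1
      apply Finset.sum_congr rfl; intro i _
      rw [← Finset.sum_sub_distrib]
      apply Finset.sum_congr rfl; intro j _
      simp only [inner_smul_left, inner_smul_right, map_pow]
      rw [mul_pow]; ring
    rw [h4]
    simp only [N]
    change ‖∑ j, w j ^ m • g j‖ ^ 2 + ‖∑ j, w j ^ m • S j (u j)‖ ^ 2
        ≤ ‖∑ j, w j ^ (m+1) • g j‖ ^ 2 + ‖∑ j, w j ^ m • u j‖ ^ 2 at h3
    linarith
  have hsum : ∀ m, N 0 - N m ≤ (∑ l ∈ Finset.range m, e l).re := by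
    intro m
    induction m with
    | zero => simp
    | succ m ih => rw [Finset.sum_range_succ, Complex.add_re]; linarith [hstep m]
  have hN : Tendsto N atTop (𝓝 0) := by
    have : Tendsto (fun m => ∑ j, w j ^ m • g j) atTop (𝓝 (∑ j, (0:ℂ) • g j)) :=
      tendsto_finsetSum _ fun j _ =>
        (tendsto_pow_atTop_nhds_zero_of_norm_lt_one (hw j)).smul_const _
    have h2 := (this.norm).pow 2
    simpa [N] using h2
  have hE : HasSum e (∑ i, ∑ j, (1 - conj (w i) * w j)⁻¹ *
      (⟪u i, u j⟫ - ⟪S i (u i), S j (u j)⟫)) := by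
    refine hasSum_sum fun i _ => hasSum_sum fun j _ => ?_
    refine HasSum.mul_right _ (hasSum_geometric_of_norm_lt_one ?_)
    rw [norm_mul, RCLike.norm_conj]
    nlinarith [hw i, hw j, norm_nonneg (w i), norm_nonneg (w j)]
  have hlim := (Complex.continuous_re.tendsto _).comp hE.tendsto_sum_nat
  have h0 : N 0 - 0 ≤ _ := le_of_tendsto_of_tendsto' (tendsto_const_nhds.sub hN) hlim hsum
  have : 0 ≤ N 0 := by positivity
  linarith

theorem dual_pos (w : ι → ℂ) (hw : ∀ i, ‖w i‖ < 1) (S : ι → (U →L[ℂ] Y))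
    (hpos : ∀ f : ι → Y, 0 ≤ (∑ i, ∑ j, (1 - w i * conj (w j))⁻¹ *
      (⟪f i, f j⟫ - ⟪adjoint (S i) (f i), adjoint (S j) (f j)⟫)).re) (u : ι → U) :
    0 ≤ (∑ i, ∑ j, (1 - conj (w i) * w j)⁻¹ *
      (⟪u i, u j⟫ - ⟪S i (u i), S j (u j)⟫)).re := by
  let K : Matrix ι ι (Y →L[ℂ] Y) := Matrix.of fun i j =>
    (1 - w i * conj (w j))⁻¹ • (1 - S i ∘L adjoint (S j))
  have hK : ∀ i j v v', ⟪K j i v, v'⟫ = (1 - w i * conj (w j))⁻¹ *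
      (⟪v, v'⟫ - ⟪adjoint (S i) v, adjoint (S j) v'⟫) := by
    intro i j v v'
    simp only [K, Matrix.of_apply, smul_apply, sub_apply,
      one_apply_eq_self, ContinuousLinearMap.comp_apply, inner_smul_left,
      inner_sub_left, adjoint_inner_right, map_inv₀, map_sub, map_one, map_mul, Complex.conj_conj]
    ring
  have hps : K.PosSemidef := by
    have ht := (RKHS.posSemidef_tfae (K := K)).out 0 2
    refine ht.2 ⟨?_, fun vv => ?_⟩
    · ext1 i j
      refine ContinuousLinearMap.ext fun v => ext_inner_right ℂ fun v' => ?_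
      rw [Matrix.conjTranspose_apply, star_eq_adjoint, adjoint_inner_left, hK,
        ← inner_conj_symm, hK]
      simp only [map_mul, map_sub, map_inv₀, map_one, Complex.conj_conj, inner_conj_symm]
      ring
    · have h := hpos (fun i => vv i)
      rw [Finsupp.sum_fintype _ _ (by simp)]
      simp_rw [hK]
      refine h.trans_eq (congrArg Complex.re ?_)
      apply Finset.sum_congr rfl; intro i _
      rw [Finsupp.sum_fintype _ _ (by simp)]
  have : Fact K.PosSemidef := ⟨hps⟩
  let k : ι → Y →L[ℂ] RKHS.OfKernel K := fun i => RKHS.kerFun (RKHS.OfKernel K) i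
  have hk : ∀ i j v v', ⟪k i v, k j v'⟫ = (1 - w i * conj (w j))⁻¹ *
      (⟪v, v'⟫ - ⟪adjoint (S i) v, adjoint (S j) v'⟫) := by
    intro i j v v'
    rw [← hK, ← RKHS.kernel_inner, RKHS.OfKernel.kernel_ofKernel]
  exact dual_pos_aux w hw S k hk u

end LemmaA


section Genuine

set_option linter.unusedSectionVars false

variable {U Y : Type*} [NormedAddCommGroup U] [InnerProductSpace ℂ U] [CompleteSpace U]
  [NormedAddCommGroup Y] [InnerProductSpace ℂ Y] [CompleteSpace Y]
  {H : Type*} [NormedAddCommGroup H] [InnerProductSpace ℂ H] [CompleteSpace H]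
  {H' : Type*} [NormedAddCommGroup H'] [InnerProductSpace ℂ H'] [CompleteSpace H']

theorem norm_lt_of_mem {S : ℂ → (U →L[ℂ] Y)} {Ω : Set ℂ} {κ : ℕ} (hS : MemGenSchur S Ω κ)
    {z : ℂ} (hz : z ∈ Ω) : ‖z‖ < 1 := by
  simpa using hS.subset hz

theorem kernel_pos_fin {S : ℂ → (U →L[ℂ] Y)} {Ω : Set ℂ} (hS : MemGenSchur S Ω 0)
    {n : ℕ} (w : Fin n → ℂ) (hw : ∀ i, w i ∈ Ω) (f : Fin n → Y) :
    0 ≤ (∑ i, ∑ j, (1 - w i * conj (w j))⁻¹ *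
      (⟪f i, f j⟫ - ⟪adjoint (S (w i)) (f i), adjoint (S (w j)) (f j)⟫)).re := by
  by_contra hneg
  push Not at hneg
  have hne : ∀ i j, 1 - w i * conj (w j) ≠ 0 := fun i j =>
    one_sub_ne (norm_lt_of_mem hS (hw i)) (by simpa using norm_lt_of_mem hS (hw j))
  have hn : n ≠ 0 := by
    rintro rfl
    simp at hneg
  have hK : ∀ i j, ⟪schurKernel S (w j) (w i) (f j), f i⟫ = (1 - w j * conj (w i))⁻¹ *
      (⟪f j, f i⟫ - ⟪adjoint (S (w j)) (f j), adjoint (S (w i)) (f i)⟫) := by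
    intro i j
    simp only [schurKernel, smul_apply, sub_apply,
      one_apply_eq_self, ContinuousLinearMap.comp_apply, inner_smul_left,
      inner_sub_left, adjoint_inner_right, map_inv₀, map_sub, map_one, map_mul, Complex.conj_conj]
    ring
  have h := hS.negSq_le n w hw f (Submodule.span ℂ {fun _ => (1:ℂ)}) (by
    intro c hc hc0
    obtain ⟨t, rfl⟩ := Submodule.mem_span_singleton.1 hc
    have ht : t ≠ 0 := by rintro rfl; simp at hc0
    have h1 : (∑ i, ∑ j, (starRingEnd ℂ ((t • fun _ : Fin n => (1:ℂ)) i)) *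
        (t • fun _ : Fin n => (1:ℂ)) j * ⟪schurKernel S (w j) (w i) (f j), f i⟫)
        = ((‖t‖ ^ 2 : ℝ) : ℂ) * ∑ i, ∑ j, (1 - w i * conj (w j))⁻¹ *
      (⟪f i, f j⟫ - ⟪adjoint (S (w i)) (f i), adjoint (S (w j)) (f j)⟫) := by
      rw [Finset.sum_comm, Finset.mul_sum]
      apply Finset.sum_congr rfl; intro i _
      rw [Finset.mul_sum]
      apply Finset.sum_congr rfl; intro j _
      rw [hK]
      simp only [Pi.smul_apply, smul_eq_mul, mul_one]
      rw [Complex.conj_mul']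
      push_cast
      ring
    rw [h1, Complex.re_ofReal_mul]
    have : 0 < ‖t‖ ^ 2 := by positivity
    exact mul_neg_of_pos_of_neg this hneg)
  rw [finrank_span_singleton] at h
  · omega
  · intro h0
    have := congrFun h0 ⟨0, Nat.pos_of_ne_zero hn⟩
    simp at this

theorem kernel_pos {S : ℂ → (U →L[ℂ] Y)} {Ω : Set ℂ} (hS : MemGenSchur S Ω 0)
    {ι : Type*} [Fintype ι] (w : ι → ℂ) (hw : ∀ i, w i ∈ Ω) (u : ι → U) :
    0 ≤ (∑ i, ∑ j, (1 - conj (w i) * w j)⁻¹ *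
      (⟪u i, u j⟫ - ⟪S (w i) (u i), S (w j) (u j)⟫)).re := by
  refine dual_pos w (fun i => norm_lt_of_mem hS (hw i)) (fun i => S (w i)) (fun f => ?_) u
  let e := (Fintype.equivFin ι).symm
  have h := kernel_pos_fin hS (w ∘ e) (fun i => hw _) (f ∘ e)
  refine h.trans_eq (congrArg Complex.re ?_)
  rw [← e.sum_comp]
  apply Finset.sum_congr rfl; intro i _
  rw [← e.sum_comp]
  rfl

/-- the linear combination map -/
abbrev lc {ι : Type*} (k : ι → H) : (ι →₀ ℂ) →ₗ[ℂ] H := Finsupp.linearCombination ℂ k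

theorem gram_apply {ι : Type*} (J : H →L[ℂ] H) (k : ι → H) (p q : ι →₀ ℂ) :
    ⟪J (lc k p), lc k q⟫ = ∑ i ∈ p.support, ∑ j ∈ q.support, conj (p i) * q j * ⟪J (k i), k j⟫ := by
  rw [Finsupp.linearCombination_apply, Finsupp.linearCombination_apply, Finsupp.sum, Finsupp.sum,
    map_sum, sum_inner]
  apply Finset.sum_congr rfl; intro i _
  rw [inner_sum]
  apply Finset.sum_congr rfl; intro j _
  rw [map_smul, inner_smul_left, inner_smul_right, mul_assoc]

theorem gram_eq {ι : Type*} {J : H →L[ℂ] H} {J' : H' →L[ℂ] H'} {k : ι → H} {k' : ι → H'}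
    (h : ∀ i j, ⟪J (k i), k j⟫ = ⟪J' (k' i), k' j⟫) (p q : ι →₀ ℂ) :
    ⟪J (lc k p), lc k q⟫ = ⟪J' (lc k' p), lc k' q⟫ := by
  rw [gram_apply, gram_apply]
  simp_rw [h]

theorem genuine_of_gen {S : ℂ → (U →L[ℂ] Y)} {Ω : Set ℂ} {κ : ℕ} (hS : MemGenSchur S Ω κ)
    {J : H →L[ℂ] H} (hJ : IsFundamentalSymmetry J κ) {E : Set ℂ} (hE : E ⊆ Ω)
    (k : ℂ → U → H) (hk : ∀ w ∈ E, ∀ z ∈ E, ∀ u v,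
      (1 - conj w * z) * ⟪J (k w u), k z v⟫ = ⟪u, v⟫ - ⟪S w u, S z v⟫)
    (hd : DenseRange (lc (fun p : E × U => k p.1 p.2))) : FiniteDimensional ℂ (negSp J) := by
  by_cases hκ : κ = 0
  · subst hκ
    refine negSp_finite_of_nonneg _ hd fun p => ?_
    rw [gram_apply]
    have h := kernel_pos hS (fun i : p.support => (i.1.1 : ℂ)) (fun i => hE i.1.1.2)
      (fun i => p i.1 • i.1.2)
    refine h.trans_eq (congrArg Complex.re ?_)
    rw [← Finset.sum_coe_sort p.support]
    apply Finset.sum_congr rfl; intro i _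
    rw [← Finset.sum_coe_sort p.support]
    apply Finset.sum_congr rfl; intro j _
    have hne : 1 - conj (i.1.1 : ℂ) * (j.1.1 : ℂ) ≠ 0 :=
      one_sub_ne (by simpa using norm_lt_of_mem hS (hE i.1.1.2)) (norm_lt_of_mem hS (hE j.1.1.2))
    have := hk _ i.1.1.2 _ j.1.1.2 i.1.2 j.1.2
    rw [inv_mul_eq_iff_eq_mul₀ hne]
    simp only [map_smul, inner_smul_left, inner_smul_right]
    linear_combination -(conj (p i.1) * p j.1) * this
  · exact isFinite_of_pos hJ hκ

/-- density of the span from the orthogonality condition -/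
theorem denseRange_of_sep {ι : Type*} {J : H →L[ℂ] H} (hJ : IsSym J) {k : ι → H}
    (h : ∀ x, (∀ i, ⟪J x, k i⟫ = 0) → x = 0) : DenseRange (lc k) := by
  have h1 : (LinearMap.range (lc k)).topologicalClosure = ⊤ := by
    rw [Submodule.topologicalClosure_eq_top_iff, Submodule.eq_bot_iff]
    intro x hx
    have h2 : J x = 0 := by
      refine h _ fun i => ?_
      rw [hJ.sq]
      refine (Submodule.mem_orthogonal' _ _).1 hx _ ⟨Finsupp.single i 1, ?_⟩
      simp
    rw [← hJ.sq x, h2, map_zero]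
  intro x
  have : x ∈ (LinearMap.range (lc k)).topologicalClosure := by rw [h1]; trivial
  exact this

theorem sep_of_denseRange {ι : Type*} {J : H →L[ℂ] H} (hJ : IsSym J) {k : ι → H}
    (h : DenseRange (lc k)) {x : H} (hx : ∀ i, ⟪J x, k i⟫ = 0) : x = 0 := by
  refine hJ.eq_zero fun y => ?_
  refine h.induction_on y (isClosed_eq (by fun_prop) (by fun_prop)) fun p => ?_
  rw [Finsupp.linearCombination_apply, Finsupp.sum, inner_sum]
  refine Finset.sum_eq_zero fun i _ => ?_
  rw [inner_smul_right, hx, mul_zero]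

end Genuine

section ProdSym

set_option linter.unusedSectionVars false

variable {X₁ X₂ : Type*} [NormedAddCommGroup X₁] [InnerProductSpace ℂ X₁] [CompleteSpace X₁]
  [NormedAddCommGroup X₂] [InnerProductSpace ℂ X₂] [CompleteSpace X₂]

theorem prodJ_apply (J₁ : X₁ →L[ℂ] X₁) (J₂ : X₂ →L[ℂ] X₂) (x : ProdState X₁ X₂) :
    prodJ J₁ J₂ x = WithLp.toLp 2 (J₁ x.fst, J₂ x.snd) := rfl

theorem inner_toLp (a c : X₁) (b d : X₂) :
    ⟪(WithLp.toLp 2 (a, b) : ProdState X₁ X₂), WithLp.toLp 2 (c, d)⟫ = ⟪a, c⟫ + ⟪b, d⟫ := by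
  rw [WithLp.prod_inner_apply]

theorem prodJ_isSym {J₁ : X₁ →L[ℂ] X₁} {J₂ : X₂ →L[ℂ] X₂} (h₁ : IsSym J₁) (h₂ : IsSym J₂) :
    IsSym (prodJ J₁ J₂) where
  sa x y := by
    simp only [prodJ_apply, WithLp.prod_inner_apply]
    change ⟪J₁ x.fst, y.fst⟫ + ⟪J₂ x.snd, y.snd⟫ = ⟪x.fst, J₁ y.fst⟫ + ⟪x.snd, J₂ y.snd⟫
    rw [h₁.sa, h₂.sa]
  sq x := by
    change WithLp.toLp 2 (J₁ (J₁ x.fst), J₂ (J₂ x.snd)) = x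
    rw [h₁.sq, h₂.sq]
    rfl

theorem one_isSym : IsSym (1 : X₁ →L[ℂ] X₁) := ⟨fun _ _ => rfl, fun _ => rfl⟩

theorem negSp_prodJ_equiv (J₁ : X₁ →L[ℂ] X₁) (J₂ : X₂ →L[ℂ] X₂) :
    Nonempty (negSp (prodJ J₁ J₂) ≃ₗ[ℂ] (negSp J₁ × negSp J₂)) := by
  refine ⟨{ toFun := fun x => (⟨x.1.fst, ?_⟩, ⟨x.1.snd, ?_⟩), invFun := fun p => ⟨WithLp.toLp 2 (p.1.1, p.2.1), ?_⟩, map_add' := fun _ _ => rfl, map_smul' := fun _ _ => rfl, left_inv := fun _ => rfl, right_inv := fun _ => rfl}⟩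
  · exact mem_negSp.2 (congrArg WithLp.fst (mem_negSp.1 x.2))
  · exact mem_negSp.2 (congrArg WithLp.snd (mem_negSp.1 x.2))
  · rw [mem_negSp]
    change WithLp.toLp 2 (J₁ p.1.1, J₂ p.2.1) = WithLp.toLp 2 (-p.1.1, -p.2.1)
    rw [mem_negSp.1 p.1.2, mem_negSp.1 p.2.2]

theorem negSp_prodJ_finite {J₁ : X₁ →L[ℂ] X₁} {J₂ : X₂ →L[ℂ] X₂}
    (h₁ : FiniteDimensional ℂ (negSp J₁)) (h₂ : FiniteDimensional ℂ (negSp J₂)) :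
    FiniteDimensional ℂ (negSp (prodJ J₁ J₂)) := by
  obtain ⟨e⟩ := negSp_prodJ_equiv J₁ J₂
  exact Module.Finite.equiv e.symm

theorem negSp_prodJ_finrank {J₁ : X₁ →L[ℂ] X₁} {J₂ : X₂ →L[ℂ] X₂}
    (h₁ : FiniteDimensional ℂ (negSp J₁)) (h₂ : FiniteDimensional ℂ (negSp J₂)) :
    Module.finrank ℂ (negSp (prodJ J₁ J₂)) =
      Module.finrank ℂ (negSp J₁) + Module.finrank ℂ (negSp J₂) := by
  obtain ⟨e⟩ := negSp_prodJ_equiv J₁ J₂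
  rw [e.finrank_eq, Module.finrank_prod]

theorem negSp_one : negSp (1 : X₁ →L[ℂ] X₁) = ⊥ := by
  rw [Submodule.eq_bot_iff]
  intro x hx
  have h : x = -x := mem_negSp.1 hx
  have h2 : (2:ℂ) • x = 0 := by rw [two_smul]; nth_rw 2 [h]; simp
  exact (smul_eq_zero.1 h2).resolve_left two_ne_zero

theorem negSp_one_finite : FiniteDimensional ℂ (negSp (1 : X₁ →L[ℂ] X₁)) := by
  rw [negSp_one]; infer_instance

theorem negSp_one_finrank : Module.finrank ℂ (negSp (1 : X₁ →L[ℂ] X₁)) = 0 := by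
  rw [negSp_one]; simp

end ProdSym


section LemmaE

set_option linter.unusedSectionVars false

theorem det_differentiableOn {n : ℕ} {s : Set ℂ} {M : ℂ → Matrix (Fin n) (Fin n) ℂ}
    (h : ∀ i j, DifferentiableOn ℂ (fun w => M w i j) s) :
    DifferentiableOn ℂ (fun w => (M w).det) s := by
  simp only [Matrix.det_apply]
  refine DifferentiableOn.fun_sum fun σ _ => ?_
  refine DifferentiableOn.const_smul ?_ _
  refine DifferentiableOn.fun_finset_prod fun i _ => h _ _

theorem adjugate_differentiableOn {n : ℕ} {s : Set ℂ} {M : ℂ → Matrix (Fin n) (Fin n) ℂ}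
    (h : ∀ i j, DifferentiableOn ℂ (fun w => M w i j) s) (i j : Fin n) :
    DifferentiableOn ℂ (fun w => (M w).adjugate i j) s := by
  simp only [Matrix.adjugate_apply]
  refine det_differentiableOn fun a b => ?_
  by_cases ha : a = j
  · subst ha; simp only [Matrix.updateRow_self]; exact differentiableOn_const _
  · simp only [Matrix.updateRow_ne ha]; exact h _ _

variable {H : Type*} [NormedAddCommGroup H] [InnerProductSpace ℂ H] [CompleteSpace H]

theorem lemmaE {J : H →L[ℂ] H} (hJ : IsSym J) [FiniteDimensional ℂ (negSp J)] (A : H →L[ℂ] H)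
    (hA : ∀ x, (⟪J (A x), A x⟫).re ≤ (⟪J x, x⟫).re) :
    ∃ (d : ℂ → ℂ) (Q : ℂ → (H →L[ℂ] H)), DifferentiableOn ℂ d (ball 0 1) ∧
      DifferentiableOn ℂ Q (ball 0 1) ∧ d 0 = 1 ∧
      ∀ w ∈ ball (0:ℂ) 1, ∀ x, d w • x = Q w (x - w • A x) := by
  let φ : H →ₗ[ℂ] negSp J := negProj J hJ ∘ₗ (A : H →ₗ[ℂ] H)
  let K : Submodule ℂ H := LinearMap.ker φ
  have hK1 : ∀ x ∈ K, ‖A x‖ ≤ ‖x‖ := by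
    intro x hx
    have h0 : negProj J hJ (A x) = 0 := hx
    have h1 := negProj_injOn hJ h0
    have h2 := hA x
    have h3 : (⟪J x, x⟫).re ≤ ‖x‖ * ‖x‖ := (Complex.re_le_norm _).trans (hJ.re_le x x)
    nlinarith [norm_nonneg (A x), norm_nonneg x]
  have hKc : IsClosed (K : Set H) := by
    have : (K : Set H) = {x | J (A x) = A x} := by
      ext x
      change negProj J hJ (A x) = 0 ↔ J (A x) = A x
      rw [← Subtype.coe_inj, negProj_coe]
      rw [Submodule.coe_zero, smul_eq_zero_iff_right (by norm_num), sub_eq_zero, eq_comm]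
    rw [this]
    exact isClosed_eq (by fun_prop) (by fun_prop)
  have : CompleteSpace K := hKc.completeSpace_coe
  have hfin : FiniteDimensional ℂ Kᗮ := by
    refine FiniteDimensional.of_injective (φ ∘ₗ Kᗮ.subtype) ?_
    rw [← LinearMap.ker_eq_bot, LinearMap.ker_eq_bot']
    intro x hx
    have h1 : (x : H) ∈ K := hx
    have h2 := K.inner_right_of_mem_orthogonal h1 x.2
    exact Subtype.ext (inner_self_eq_zero.1 h2)
  let b := stdOrthonormalBasis ℂ Kᗮ
  let n := Module.finrank ℂ Kᗮ
  let C : H →L[ℂ] H := A ∘L K.starProjection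
  have hC : ‖C‖ ≤ 1 := by
    refine C.opNorm_le_bound zero_le_one fun x => ?_
    rw [one_mul]
    exact (hK1 _ (K.starProjection_apply_mem x)).trans (K.norm_starProjection_apply_le x)
  have hAC : ∀ x, A x = C x + ∑ j, ⟪(b j : H), x⟫ • A (b j) := by
    intro x
    have h1 : x = K.starProjection x + Kᗮ.starProjection x := by
      rw [Submodule.starProjection_orthogonal_val]; abel
    have h2 : Kᗮ.starProjection x = ∑ j, ⟪(b j : H), x⟫ • (b j : H) := by
      have h3 := congrArg (Subtype.val) (b.orthogonalProjectionOnto_apply_eq_sum x)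
      rw [Submodule.starProjection_apply, h3]
      simp
    conv_lhs => rw [h1, h2]
    simp [C]
  let R : ℂ → (H →L[ℂ] H) := fun w => Ring.inverse (1 - w • C)
  have hu : ∀ w ∈ ball (0:ℂ) 1, IsUnit (1 - w • C) := by
    intro w hw
    refine isUnit_one_sub_of_norm_lt_one ?_
    rw [norm_smul]
    have : ‖w‖ < 1 := by simpa using hw
    nlinarith [norm_nonneg w, norm_nonneg C]
  have hR : DifferentiableOn ℂ R (ball 0 1) := by
    intro w hw
    refine DifferentiableAt.differentiableWithinAt ?_
    have h1 : DifferentiableAt ℂ Ring.inverse (1 - w • C) := differentiableAt_inverse (hu w hw)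
    have h2 : DifferentiableAt ℂ (fun w : ℂ => 1 - w • C) w := by fun_prop
    exact DifferentiableAt.comp w h1 h2
  let M : ℂ → Matrix (Fin n) (Fin n) ℂ := fun w => Matrix.of fun i j =>
    (if i = j then 1 else 0) - w * ⟪(b i : H), R w (A (b j))⟫
  have hM : ∀ i j, DifferentiableOn ℂ (fun w => M w i j) (ball 0 1) := by
    intro i j
    have h1 : DifferentiableOn ℂ (fun w => (innerSL ℂ (b i : H)) (R w (A (b j)))) (ball 0 1) :=
      (innerSL ℂ (b i : H)).differentiable.comp_differentiableOn
        (hR.clm_apply (differentiableOn_const _))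
    exact (differentiableOn_const _).sub (differentiableOn_id.mul h1)
  let G : Fin n → Fin n → (H →L[ℂ] H) := fun i j => (innerSL ℂ (b i : H)).smulRight (A (b j))
  refine ⟨fun w => (M w).det, fun w => (M w).det • R w + w • ∑ j, ∑ i, (M w).adjugate j i •
    (R w ∘L (G i j ∘L R w)), det_differentiableOn hM, ?_, ?_, ?_⟩
  · refine ((det_differentiableOn hM).fun_smul hR).fun_add (differentiableOn_id.fun_smul ?_)
    refine DifferentiableOn.fun_sum fun j _ => DifferentiableOn.fun_sum fun i _ => ?_
    exact (adjugate_differentiableOn hM j i).fun_smul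
      (hR.clm_comp ((differentiableOn_const _).clm_comp hR))
  · have : M 0 = 1 := by ext i j; simp [M, Matrix.one_apply]
    simp [this]
  · intro w hw x
    have hRx : R w (x - w • A x) = x - w • ∑ j, ⟪(b j : H), x⟫ • R w (A (b j)) := by
      have h1 : ∀ y, R w ((1 - w • C) y) = y := by
        intro y
        have := Ring.inverse_mul_cancel _ (hu w hw)
        exact congrArg (fun T : H →L[ℂ] H => T y) this
      have h2 : x - w • A x = (1 - w • C) x - w • ∑ j, ⟪(b j : H), x⟫ • A (b j) := by
        rw [hAC x]; simp [smul_add]; abel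
      rw [h2, map_sub, h1, map_smul, map_sum]
      simp only [map_smul]
    have hξ : ∀ i, ⟪(b i : H), R w (x - w • A x)⟫ = ((M w).mulVec fun j => ⟪(b j : H), x⟫) i := by
      intro i
      rw [hRx, inner_sub_right, inner_smul_right, inner_sum]
      simp only [Matrix.mulVec, dotProduct, M, Matrix.of_apply, sub_mul, Finset.sum_sub_distrib,
        inner_smul_right, ite_mul, one_mul, zero_mul, Finset.sum_ite_eq, Finset.mem_univ, if_true,
        Finset.mul_sum]
      congr 1
      apply Finset.sum_congr rfl; intro j _; ring
    have hadj : ∀ j, ∑ i, (M w).adjugate j i * ⟪(b i : H), R w (x - w • A x)⟫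
        = (M w).det * ⟪(b j : H), x⟫ := by
      intro j
      simp_rw [hξ]
      have := congrFun (Matrix.mulVec_mulVec (fun j => ⟪(b j : H), x⟫) (M w).adjugate (M w)) j
      rw [Matrix.adjugate_mul, Matrix.smul_mulVec, Matrix.one_mulVec] at this
      simpa [Matrix.mulVec, dotProduct] using this
    simp only [add_apply, smul_apply, ContinuousLinearMap.sum_apply, ContinuousLinearMap.comp_apply]
    have hG : ∀ i j y, R w (G i j y) = ⟪(b i : H), y⟫ • R w (A (b j)) := by
      intro i j y; simp [G]
    simp only [hG, smul_smul, ← Finset.sum_smul, hadj]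
    rw [hRx]
    simp only [smul_sub, Finset.smul_sum, smul_smul]
    rw [sub_add]
    nth_rw 1 [← sub_zero ((M w).det • x)]
    congr 1
    rw [eq_comm, sub_eq_zero]
    apply Finset.sum_congr rfl; intro j _
    congr 1; ring

end LemmaE


section Kernels

set_option linter.unusedSectionVars false

variable {U Y : Type*} [NormedAddCommGroup U] [InnerProductSpace ℂ U] [CompleteSpace U]
  [NormedAddCommGroup Y] [InnerProductSpace ℂ Y] [CompleteSpace Y]
  {H : Type*} [NormedAddCommGroup H] [InnerProductSpace ℂ H] [CompleteSpace H]

/-- kernel sections of the space `H(S^#)`, parametrised by the conjugate variable. -/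
structure IsKer (S : ℂ → (U →L[ℂ] Y)) (Ω : Set ℂ) (J : H →L[ℂ] H) (k : ℂ → U → H) : Prop where
  sym : IsSym J
  fin : FiniteDimensional ℂ (negSp J)
  gram : ∀ w ∈ Ω, ∀ z ∈ Ω, ∀ u v,
      (1 - conj w * z) * ⟪J (k w u), k z v⟫ = ⟪u, v⟫ - ⟪S w u, S z v⟫
  sep : ∀ h, (∀ w ∈ Ω, ∀ u, ⟪J h, k w u⟫ = 0) → h = 0

theorem dense_of_sep' {Ω : Set ℂ} {J : H →L[ℂ] H} (hJ : IsSym J) {k : ℂ → U → H}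
    (hs : ∀ h, (∀ w ∈ Ω, ∀ u, ⟪J h, k w u⟫ = 0) → h = 0) :
    DenseRange (lc (fun p : Ω × U => k p.1 p.2)) :=
  denseRange_of_sep hJ fun x hx => hs x fun w hw u => hx (⟨w, hw⟩, u)

theorem exists_isKer {S : ℂ → (U →L[ℂ] Y)} {Ω : Set ℂ} {κ : ℕ} (hS : MemGenSchur S Ω κ)
    (hΩ : ∀ z ∈ Ω, starRingEnd ℂ z ∈ Ω) {J : H →L[ℂ] H} {ev : H →ₗ[ℂ] (ℂ → U)}
    (hH : IsRKPS (sharp S) Ω κ J ev) :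
    ∃ k : ℂ → U → H, IsKer S Ω J k ∧ ∀ w ∈ Ω, ∀ u h, ⟪J h, k w u⟫ = ⟪ev h (conj w), u⟫ := by
  have h1 : ∀ w : ℂ, ∀ u : U, ∃ k : H, w ∈ Ω → (∀ z ∈ Ω, ev k z = schurKernel (sharp S) (conj w) z u) ∧
      ∀ h : H, ⟪J h, k⟫ = ⟪ev h (conj w), u⟫ := by
    intro w u
    by_cases hw : w ∈ Ω
    · obtain ⟨k, hk⟩ := hH.repro (conj w) (hΩ w hw) u
      exact ⟨k, fun _ => hk⟩
    · exact ⟨0, fun h => absurd h hw⟩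
  choose k hk using h1
  have hgram : ∀ w ∈ Ω, ∀ z ∈ Ω, ∀ u v,
      (1 - conj w * z) * ⟪J (k w u), k z v⟫ = ⟪u, v⟫ - ⟪S w u, S z v⟫ := by
    intro w hw z hz u v
    rw [(hk z v hz).2, (hk w u hw).1 _ (hΩ z hz)]
    have hne : 1 - conj w * z ≠ 0 :=
      one_sub_ne (by simpa using norm_lt_of_mem hS hw) (norm_lt_of_mem hS hz)
    simp only [schurKernel, sharp, smul_apply, sub_apply, one_apply_eq_self,
      ContinuousLinearMap.comp_apply, inner_smul_left, inner_sub_left, map_inv₀, map_sub, map_one,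
      map_mul, Complex.conj_conj, adjoint_adjoint, adjoint_inner_left]
    rw [mul_comm z (conj w), ← mul_assoc, mul_inv_cancel₀ hne, one_mul]
  have hsep : ∀ h, (∀ w ∈ Ω, ∀ u, ⟪J h, k w u⟫ = 0) → h = 0 := by
    intro h hh
    refine hH.sep h fun z hz => ?_
    refine ext_inner_right ℂ fun u => ?_
    rw [inner_zero_left, ← hh (conj z) (hΩ z hz) u, (hk _ u (hΩ z hz)).2, Complex.conj_conj]
  have hJ := hH.fund.isSym
  exact ⟨k, ⟨hJ, genuine_of_gen hS hH.fund subset_rfl k hgram (dense_of_sep' hJ hsep), hgram, hsep⟩,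
    fun w hw u h => (hk w u hw).2 h⟩

variable {S : ℂ → (U →L[ℂ] Y)} {Ω : Set ℂ} {κ : ℕ} {J : H →L[ℂ] H} {k : ℂ → U → H}

theorem IsKer.gram' (hK : IsKer S Ω J k) (hS : MemGenSchur S Ω κ) {w z : ℂ} (hw : w ∈ Ω)
    (hz : z ∈ Ω) (u v : U) :
    ⟪J (k w u), k z v⟫ = (1 - conj w * z)⁻¹ * (⟪u, v⟫ - ⟪S w u, S z v⟫) := by
  have hne : 1 - conj w * z ≠ 0 :=
      one_sub_ne (by simpa using norm_lt_of_mem hS hw) (norm_lt_of_mem hS hz)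
  rw [← hK.gram w hw z hz, inv_mul_cancel_left₀ hne]

theorem IsKer.continuousOn (hK : IsKer S Ω J k) (hS : MemGenSchur S Ω κ) {y : ℂ → U}
    (hy : ContinuousOn y Ω) : ContinuousOn (fun v => k v (y v)) Ω := by
  have := hK.fin
  intro v₀ hv₀
  obtain ⟨n, p, hp⟩ := exists_norm_est hK.sym _ (dense_of_sep' hK.sym hK.sep)
  have hSy : ContinuousOn (fun v => S v (y v)) Ω := hS.holo.continuousOn.clm_apply hy
  have hyt : Tendsto y (𝓝[Ω] v₀) (𝓝 (y v₀)) := hy v₀ hv₀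
  have hSt : Tendsto (fun v => S v (y v)) (𝓝[Ω] v₀) (𝓝 (S v₀ (y v₀))) := hSy v₀ hv₀
  have hid : Tendsto (fun v : ℂ => v) (𝓝[Ω] v₀) (𝓝 v₀) := tendsto_nhdsWithin_of_tendsto_nhds tendsto_id
  have hconj : Tendsto (fun v : ℂ => conj v) (𝓝[Ω] v₀) (𝓝 (conj v₀)) :=
    (Complex.continuous_conj.tendsto _).comp hid
  have hmem : ∀ᶠ v in 𝓝[Ω] v₀, v ∈ Ω := self_mem_nhdsWithin
  have hne : ∀ {w z : ℂ}, w ∈ Ω → z ∈ Ω → 1 - conj w * z ≠ 0 := fun hw hz =>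
      one_sub_ne (by simpa using norm_lt_of_mem hS hw) (norm_lt_of_mem hS hz)
  -- left variable
  have hL : ∀ z ∈ Ω, ∀ x, Tendsto (fun v => ⟪J (k v (y v)), k z x⟫) (𝓝[Ω] v₀)
      (𝓝 ⟪J (k v₀ (y v₀)), k z x⟫) := by
    intro z hz x
    rw [hK.gram' hS hv₀ hz]
    refine Tendsto.congr' (hmem.mono fun v hv => (hK.gram' hS hv hz _ _).symm) ?_
    exact ((tendsto_const_nhds.sub (hconj.mul tendsto_const_nhds)).inv₀ (hne hv₀ hz)).mul
      ((hyt.inner tendsto_const_nhds).sub (hSt.inner tendsto_const_nhds))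
  have hR : Tendsto (fun v => ⟪J (k v₀ (y v₀)), k v (y v)⟫) (𝓝[Ω] v₀)
      (𝓝 ⟪J (k v₀ (y v₀)), k v₀ (y v₀)⟫) := by
    rw [hK.gram' hS hv₀ hv₀]
    refine Tendsto.congr' (hmem.mono fun v hv => (hK.gram' hS hv₀ hv _ _).symm) ?_
    exact ((tendsto_const_nhds.sub (tendsto_const_nhds.mul hid)).inv₀ (hne hv₀ hv₀)).mul
      ((tendsto_const_nhds.inner hyt).sub (tendsto_const_nhds.inner hSt))
  have hB : Tendsto (fun v => ⟪J (k v (y v)), k v (y v)⟫) (𝓝[Ω] v₀)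
      (𝓝 ⟪J (k v₀ (y v₀)), k v₀ (y v₀)⟫) := by
    rw [hK.gram' hS hv₀ hv₀]
    refine Tendsto.congr' (hmem.mono fun v hv => (hK.gram' hS hv hv _ _).symm) ?_
    exact ((tendsto_const_nhds.sub (hconj.mul hid)).inv₀ (hne hv₀ hv₀)).mul
      ((hyt.inner hyt).sub (hSt.inner hSt))
  let x : ℂ → H := fun v => k v (y v) - k v₀ (y v₀)
  have h1 : Tendsto (fun v => ⟪J (x v), x v⟫) (𝓝[Ω] v₀) (𝓝 0) := by
    have := (hB.sub (hL v₀ hv₀ (y v₀))).sub (hR.sub (tendsto_const_nhds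
      (x := ⟪J (k v₀ (y v₀)), k v₀ (y v₀)⟫)))
    simp only [sub_self] at this
    refine this.congr fun v => ?_
    simp only [x, map_sub, inner_sub_left, inner_sub_right]
    ring
  have h2 : ∀ i, Tendsto (fun v => ⟪J (x v), lc (fun p : Ω × U => k p.1 p.2) (p i)⟫) (𝓝[Ω] v₀) (𝓝 0) := by
    intro i
    have : Tendsto (fun v => ∑ j ∈ (p i).support, (p i) j * ⟪J (x v), k j.1 j.2⟫) (𝓝[Ω] v₀)
        (𝓝 (∑ j ∈ (p i).support, (p i) j * 0)) := by
      refine tendsto_finsetSum _ fun j _ => Tendsto.const_mul _ ?_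
      have h3 := (hL j.1 j.1.2 j.2).sub (tendsto_const_nhds (x := ⟪J (k v₀ (y v₀)), k j.1 j.2⟫))
      simp only [sub_self] at h3
      refine h3.congr fun v => ?_
      simp only [x, map_sub, inner_sub_left]
    simp only [mul_zero, Finset.sum_const_zero] at this
    refine this.congr fun v => ?_
    rw [Finsupp.linearCombination_apply, Finsupp.sum, inner_sum]
    simp only [inner_smul_right]
  have h3 : Tendsto (fun v => 2 * |(⟪J (x v), x v⟫).re| + 8 * (∑ i, ‖⟪J (x v), lc (fun p : Ω × U => k p.1 p.2) (p i)⟫‖) ^ 2)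
      (𝓝[Ω] v₀) (𝓝 (2 * |(0:ℂ).re| + 8 * (∑ _i : Fin n, ‖(0:ℂ)‖) ^ 2)) := by
    refine Tendsto.add (Tendsto.const_mul _ ((Complex.continuous_re.tendsto _).comp h1).abs)
      (Tendsto.const_mul _ ((tendsto_finsetSum _ fun i _ => (h2 i).norm).pow 2))
  simp only [Complex.zero_re, abs_zero, norm_zero, Finset.sum_const_zero, mul_zero, ne_eq,
    OfNat.ofNat_ne_zero, not_false_eq_true, zero_pow, add_zero] at h3
  have h4 : Tendsto (fun v => ‖x v‖ ^ 2) (𝓝[Ω] v₀) (𝓝 0) :=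
    squeeze_zero (fun v => by positivity) (fun v => hp (x v)) h3
  have h5 : Tendsto (fun v => ‖x v‖) (𝓝[Ω] v₀) (𝓝 0) := by
    have := h4.sqrt
    simpa [Real.sqrt_sq] using this
  exact tendsto_iff_norm_sub_tendsto_zero.2 h5

theorem IsKer.factor (hK : IsKer S Ω J k) (hS : MemGenSchur S Ω κ) :
    ∃ (d : ℂ → ℂ) (Q : ℂ → (U →L[ℂ] H)) (s : ℂ → (U →L[ℂ] Y)),
      DifferentiableOn ℂ d (ball 0 1) ∧ DifferentiableOn ℂ Q (ball 0 1) ∧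
      DifferentiableOn ℂ s (ball 0 1) ∧ d 0 = 1 ∧
      ∀ v ∈ Ω, ∀ u, d v • k v u = Q v u ∧ d v • S v u = s v u := by
  have := hK.fin
  let a : Ω × U → ProdState H U := fun p => WithLp.toLp 2 ((p.1 : ℂ) • k p.1 p.2, p.2)
  let b : Ω × U → ProdState H Y := fun p => WithLp.toLp 2 (k p.1 p.2, S p.1 p.2)
  have sU : IsSym (prodJ J (1 : U →L[ℂ] U)) := prodJ_isSym hK.sym one_isSym
  have sY : IsSym (prodJ J (1 : Y →L[ℂ] Y)) := prodJ_isSym hK.sym one_isSym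
  have fU := negSp_prodJ_finite hK.fin (negSp_one_finite (X₁ := U))
  have fY := negSp_prodJ_finite hK.fin (negSp_one_finite (X₁ := Y))
  have hgr : ∀ i j, ⟪prodJ J 1 (a i), a j⟫ = ⟪prodJ J 1 (b i), b j⟫ := by
    rintro ⟨⟨w, hw⟩, u⟩ ⟨⟨z, hz⟩, v⟩
    simp only [a, b, prodJ_apply, inner_toLp]
    change ⟪J (w • k w u), z • k z v⟫ + ⟪u, v⟫ = ⟪J (k w u), k z v⟫ + ⟪S w u, S z v⟫
    have := hK.gram w hw z hz u v
    rw [map_smul, inner_smul_left, inner_smul_right]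
    linear_combination -this
  have hda : DenseRange (lc a) := by
    refine denseRange_of_sep sU fun x hx => ?_
    have hx' : ∀ w ∈ Ω, ∀ u, w * ⟪J x.fst, k w u⟫ + ⟪x.snd, u⟫ = 0 := by
      intro w hw u
      have := hx (⟨w, hw⟩, u)
      simp only [a, prodJ_apply, inner_toLp] at this
      rw [inner_smul_right] at this
      exact this
    have h2 : x.snd = 0 := by
      refine ext_inner_right ℂ fun u => ?_
      have := hx' 0 hS.zero_mem u
      rw [inner_zero_left]; simpa using this
    have h1 : x.fst = 0 := by
      refine hK.sep _ fun w hw u => ?_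
      have hne : ∀ w ∈ Ω, w ≠ 0 → ⟪J x.fst, k w u⟫ = 0 := by
        intro w hw hw0
        have := hx' w hw u
        rw [h2, inner_zero_left, add_zero] at this
        exact (mul_eq_zero.1 this).resolve_left hw0
      by_cases hw0 : w = 0
      · subst hw0
        have hc : ContinuousOn (fun v => ⟪J x.fst, k v u⟫) Ω :=
          continuousOn_const.inner (hK.continuousOn hS (y := fun _ => u) continuousOn_const)
        have hca : Tendsto (fun v => ⟪J x.fst, k v u⟫) (𝓝[≠] 0) (𝓝 ⟪J x.fst, k 0 u⟫) :=
          (hc.continuousAt (hS.isOpen.mem_nhds hw)).tendsto.mono_left nhdsWithin_le_nhds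
        refine tendsto_nhds_unique hca (tendsto_const_nhds.congr' ?_)
        filter_upwards [self_mem_nhdsWithin, nhdsWithin_le_nhds (hS.isOpen.mem_nhds hw)] with v hv hvΩ
        exact (hne v hvΩ hv).symm
      · exact hne w hw hw0
    have h3 : x = WithLp.toLp 2 (x.fst, x.snd) := rfl
    rw [h3, h1, h2]; rfl
  obtain ⟨T, hT⟩ := exists_bounded sU sY (by
    rw [negSp_prodJ_finrank hK.fin negSp_one_finite, negSp_prodJ_finrank hK.fin negSp_one_finite,
      negSp_one_finrank, negSp_one_finrank]) (lc a) (lc b) hda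
      (fun p => le_of_eq (congrArg Complex.re (gram_eq hgr p p).symm))
  have hTa : ∀ w ∈ Ω, ∀ u, T (WithLp.toLp 2 (w • k w u, u)) = WithLp.toLp 2 (k w u, S w u) := by
    intro w hw u
    have := hT (Finsupp.single (⟨w, hw⟩, u) 1)
    simpa [a, b] using this
  have hTiso : ∀ x, ⟪prodJ J 1 (T x), T x⟫ = ⟪prodJ J 1 x, x⟫ := by
    intro x
    refine hda.induction_on x (isClosed_eq (by fun_prop) (by fun_prop)) fun p => ?_
    rw [hT, gram_eq hgr]
  let i1 : H →L[ℂ] ProdState H U := eP.symm.toContinuousLinearMap ∘L ContinuousLinearMap.inl ℂ H U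
  let i2 : U →L[ℂ] ProdState H U := eP.symm.toContinuousLinearMap ∘L ContinuousLinearMap.inr ℂ H U
  let p1 : ProdState H Y →L[ℂ] H := ContinuousLinearMap.fst ℂ H Y ∘L eP.toContinuousLinearMap
  let p2 : ProdState H Y →L[ℂ] Y := ContinuousLinearMap.snd ℂ H Y ∘L eP.toContinuousLinearMap
  let A : H →L[ℂ] H := p1 ∘L T ∘L i1
  let B : U →L[ℂ] H := p1 ∘L T ∘L i2
  let C : H →L[ℂ] Y := p2 ∘L T ∘L i1
  let D : U →L[ℂ] Y := p2 ∘L T ∘L i2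
  have hsplit : ∀ (x : H) (u : U), T (WithLp.toLp 2 (x, u)) = WithLp.toLp 2 (A x + B u, C x + D u) := by
    intro x u
    have h1 : (WithLp.toLp 2 (x, u) : ProdState H U) = i1 x + i2 u := by
      change (WithLp.toLp 2 (x, u) : ProdState H U) = WithLp.toLp 2 (x + 0, 0 + u)
      rw [add_zero, zero_add]
    rw [h1, map_add]; rfl
  have hA : ∀ x, (⟪J (A x), A x⟫).re ≤ (⟪J x, x⟫).re := by
    intro x
    have h1 := hTiso (WithLp.toLp 2 (x, 0))
    rw [hsplit] at h1
    simp only [prodJ_apply, inner_toLp, map_zero, add_zero, inner_zero_right] at h1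
    change ⟪J (A x), A x⟫ + ⟪C x, C x⟫ = ⟪J x, x⟫ at h1
    rw [← h1, Complex.add_re]
    have : 0 ≤ (⟪C x, C x⟫).re := inner_self_nonneg (𝕜 := ℂ)
    linarith
  have hAB : ∀ w ∈ Ω, ∀ u, k w u = w • A (k w u) + B u ∧ S w u = w • C (k w u) + D u := by
    intro w hw u
    have h1 := hTa w hw u
    rw [hsplit] at h1
    have h2 := congrArg WithLp.fst h1
    have h3 := congrArg WithLp.snd h1
    simp only [map_smul] at h2 h3
    exact ⟨h2.symm, h3.symm⟩
  obtain ⟨d, Q, hd, hQ, hd0, hdQ⟩ := lemmaE hK.sym A hA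
  refine ⟨d, fun v => Q v ∘L B, fun v => v • (C ∘L (Q v ∘L B)) + d v • D, hd, ?_, ?_, hd0, ?_⟩
  · exact hQ.clm_comp (differentiableOn_const _)
  · exact (differentiableOn_id.fun_smul ((differentiableOn_const _).clm_comp
      (hQ.clm_comp (differentiableOn_const _)))).fun_add (hd.fun_smul (differentiableOn_const _))
  · intro v hv u
    obtain ⟨h1, h2⟩ := hAB v hv u
    have h3 : d v • k v u = Q v (B u) := by
      rw [hdQ v (hS.subset hv)]
      congr 1
      nth_rw 1 [h1]
      abel
    refine ⟨h3, ?_⟩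
    simp only [add_apply, smul_apply, ContinuousLinearMap.comp_apply]
    rw [h2, ← h3, smul_add, map_smul, smul_comm]

theorem analytic_core {Ω : Set ℂ} (hO : IsOpen Ω) (hsub : Ω ⊆ ball 0 1) {F D G : ℂ → ℂ}
    (hF : ContinuousOn F Ω) (hD : DifferentiableOn ℂ D (ball 0 1))
    (hG : DifferentiableOn ℂ G (ball 0 1)) (hD0 : D 0 ≠ 0) (h : ∀ v ∈ Ω, D v * F v = G v)
    (h0 : (0:ℂ) ∈ Ω) (hz : ∀ᶠ v in 𝓝 0, F v = 0) : ∀ v ∈ Ω, F v = 0 := by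
  have hc : IsPreconnected (ball (0:ℂ) 1) := (convex_ball _ _).isPreconnected
  have hDa := hD.analyticOnNhd isOpen_ball
  have hGa := hG.analyticOnNhd isOpen_ball
  have hG0 : Set.EqOn G 0 (ball 0 1) := by
    refine hGa.eqOn_zero_of_preconnected_of_eventuallyEq_zero hc (hsub h0) ?_
    filter_upwards [hz, hO.mem_nhds h0] with v hv hvΩ
    rw [← h v hvΩ, hv, mul_zero]; rfl
  intro v hv
  have hDv : ∀ᶠ z in 𝓝[≠] v, D z ≠ 0 := by
    refine (hDa v (hsub hv)).eventually_eq_zero_or_eventually_ne_zero.resolve_left fun hh => hD0 ?_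
    exact hDa.eqOn_zero_of_preconnected_of_eventuallyEq_zero hc (hsub hv) hh (hsub h0)
  have hca : Tendsto F (𝓝[≠] v) (𝓝 (F v)) :=
    (hF.continuousAt (hO.mem_nhds hv)).tendsto.mono_left nhdsWithin_le_nhds
  refine tendsto_nhds_unique hca (tendsto_const_nhds.congr' ?_)
  filter_upwards [hDv, nhdsWithin_le_nhds (hO.mem_nhds hv)] with z hz1 hz2
  have h1 := h z hz2
  rw [hG0 (hsub hz2)] at h1
  exact ((mul_eq_zero.1 h1).resolve_left hz1).symm

theorem IsKer.sep_near (hK : IsKer S Ω J k) (hS : MemGenSchur S Ω κ) {h : H}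
    (hh : ∀ u, ∀ᶠ v in 𝓝 0, ⟪J h, k v u⟫ = 0) : h = 0 := by
  obtain ⟨d, Q, s, hd, hQ, hs, hd0, hf⟩ := hK.factor hS
  refine hK.sep h fun w hw u => ?_
  refine analytic_core hS.isOpen hS.subset (F := fun v => ⟪J h, k v u⟫) (D := d)
    (G := fun v => ⟪J h, Q v u⟫) ?_ hd ?_ (by simp [hd0]) ?_ hS.zero_mem (hh u) w hw
  · exact continuousOn_const.inner (hK.continuousOn hS (y := fun _ => u) continuousOn_const)
  · exact (innerSL ℂ (J h)).differentiable.comp_differentiableOn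
      (hQ.clm_apply (differentiableOn_const _))
  · intro v hv
    rw [← (hf v hv u).1, inner_smul_right]

end Kernels

section Propagation

variable {U Y₁ Y : Type*} [NormedAddCommGroup U] [InnerProductSpace ℂ U] [CompleteSpace U]
  [NormedAddCommGroup Y] [InnerProductSpace ℂ Y] [CompleteSpace Y]
  [NormedAddCommGroup Y₁] [InnerProductSpace ℂ Y₁] [CompleteSpace Y₁]
  {H1 : Type*} [NormedAddCommGroup H1] [InnerProductSpace ℂ H1] [CompleteSpace H1]
  {H2 : Type*} [NormedAddCommGroup H2] [InnerProductSpace ℂ H2] [CompleteSpace H2]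
  {HS : Type*} [NormedAddCommGroup HS] [InnerProductSpace ℂ HS] [CompleteSpace HS]

theorem propagate {S₁ : ℂ → (U →L[ℂ] Y₁)} {S₂ : ℂ → (Y₁ →L[ℂ] Y)} {Ω : Set ℂ} {κ₁ κ₂ κS : ℕ}
    (hS₁ : MemGenSchur S₁ Ω κ₁) (hS₂ : MemGenSchur S₂ Ω κ₂)
    (hS : MemGenSchur (fun z => S₂ z ∘L S₁ z) Ω κS)
    {J1 : H1 →L[ℂ] H1} {k1 : ℂ → U → H1} {J2 : H2 →L[ℂ] H2} {k2 : ℂ → Y₁ → H2}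
    {JS : HS →L[ℂ] HS} {kS : ℂ → U → HS} (hK1 : IsKer S₁ Ω J1 k1) (hK2 : IsKer S₂ Ω J2 k2)
    (hKS : IsKer (fun z => S₂ z ∘L S₁ z) Ω JS kS) (g : HS) (h₂ : H2) (h₁ : H1)
    (hn : ∀ u, ∀ᶠ v in 𝓝 0, ⟪JS g, kS v u⟫ = ⟪J2 h₂, k2 v (S₁ v u)⟫ + ⟪J1 h₁, k1 v u⟫) :
    ∀ v ∈ Ω, ∀ u, ⟪JS g, kS v u⟫ = ⟪J2 h₂, k2 v (S₁ v u)⟫ + ⟪J1 h₁, k1 v u⟫ := by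
  obtain ⟨d1, Q1, s1, hd1, hQ1, hs1, hd10, hf1⟩ := hK1.factor hS₁
  obtain ⟨d2, Q2, s2, hd2, hQ2, hs2, hd20, hf2⟩ := hK2.factor hS₂
  obtain ⟨dS, QS, sS, hdS, hQS, hsS, hdS0, hfS⟩ := hKS.factor hS
  intro v hv u
  have key := analytic_core hS.isOpen hS.subset
    (F := fun v => ⟪JS g, kS v u⟫ - ⟪J2 h₂, k2 v (S₁ v u)⟫ - ⟪J1 h₁, k1 v u⟫)
    (D := fun v => dS v * d1 v * d2 v)
    (G := fun v => d1 v * d2 v * ⟪JS g, QS v u⟫ - dS v * ⟪J2 h₂, Q2 v (s1 v u)⟫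
      - dS v * d2 v * ⟪J1 h₁, Q1 v u⟫) ?_ ((hdS.fun_mul hd1).fun_mul hd2) ?_ ?_ ?_ hS.zero_mem ?_ v hv
  · linear_combination key
  · have hc : ContinuousOn (fun v => S₁ v u) Ω := hS₁.holo.continuousOn.clm_apply continuousOn_const
    exact ((continuousOn_const.inner (hKS.continuousOn hS (y := fun _ => u) continuousOn_const)).sub
      (continuousOn_const.inner (hK2.continuousOn hS₂ hc))).sub
      (continuousOn_const.inner (hK1.continuousOn hS₁ (y := fun _ => u) continuousOn_const))
  · have e1 : DifferentiableOn ℂ (fun v => ⟪JS g, QS v u⟫) (ball 0 1) :=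
      (innerSL ℂ (JS g)).differentiable.comp_differentiableOn
        (hQS.clm_apply (differentiableOn_const _))
    have e2 : DifferentiableOn ℂ (fun v => ⟪J2 h₂, Q2 v (s1 v u)⟫) (ball 0 1) :=
      (innerSL ℂ (J2 h₂)).differentiable.comp_differentiableOn
        (hQ2.clm_apply (hs1.clm_apply (differentiableOn_const _)))
    have e3 : DifferentiableOn ℂ (fun v => ⟪J1 h₁, Q1 v u⟫) (ball 0 1) :=
      (innerSL ℂ (J1 h₁)).differentiable.comp_differentiableOn
        (hQ1.clm_apply (differentiableOn_const _))
    exact (((hd1.fun_mul hd2).fun_mul e1).fun_sub (hdS.fun_mul e2)).fun_sub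
      ((hdS.fun_mul hd2).fun_mul e3)
  · simp [hd10, hd20, hdS0]
  · intro v hv
    rw [← (hfS v hv u).1, ← (hf1 v hv u).1, ← (hf1 v hv u).2, map_smul, ← (hf2 v hv _).1]
    simp only [inner_smul_right]
    ring
  · filter_upwards [hn u] with v hv
    rw [hv]; ring

end Propagation


section Realizations

set_option linter.unusedSectionVars false

variable {U Y X : Type*} [NormedAddCommGroup U] [InnerProductSpace ℂ U] [CompleteSpace U]
  [NormedAddCommGroup Y] [InnerProductSpace ℂ Y] [CompleteSpace Y]
  [NormedAddCommGroup X] [InnerProductSpace ℂ X] [CompleteSpace X]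
  {H : Type*} [NormedAddCommGroup H] [InnerProductSpace ℂ H] [CompleteSpace H]

/-- the state `(1 - zA)⁻¹ B u`. -/
def st (A : X →L[ℂ] X) (B : U →L[ℂ] X) (z : ℂ) (u : U) : X :=
  Ring.inverse ((1 : X →L[ℂ] X) - z • A) (B u)

variable {A : X →L[ℂ] X} {B : U →L[ℂ] X} {C : X →L[ℂ] Y} {D : U →L[ℂ] Y}
  {S : ℂ → (U →L[ℂ] Y)} {J : X →L[ℂ] X}

theorem st_eq {z : ℂ} (h : IsUnit ((1 : X →L[ℂ] X) - z • A)) (u : U) :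
    A (z • st A B z u) + B u = st A B z u := by
  have h1 := DFunLike.congr_fun (Ring.mul_inverse_cancel _ h) (B u)
  have h2 : st A B z u - z • A (st A B z u) = B u := h1
  rw [map_smul, ← h2]; abel

theorem st_unique {z : ℂ} (h : IsUnit ((1 : X →L[ℂ] X) - z • A)) {u : U} {x : X}
    (hx : A (z • x) + B u = x) : st A B z u = x := by
  have h1 := DFunLike.congr_fun (Ring.inverse_mul_cancel _ h) x
  have h2 : B u = ((1 : X →L[ℂ] X) - z • A) x := by
    have h3 : ((1 : X →L[ℂ] X) - z • A) x = x - z • A x := rfl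
    rw [h3, eq_sub_iff_add_eq, add_comm, ← map_smul]; exact hx
  unfold st
  rw [h2]; exact h1

theorem st_zero (u : U) : st A B 0 u = B u := by
  simp [st]

theorem transfer_st {z : ℂ} (h : transferAt A B C D z = S z) (u : U) :
    C (z • st A B z u) + D u = S z u := by
  rw [← h, map_smul, add_comm]; rfl

theorem isUnit_near (A : X →L[ℂ] X) : ∀ᶠ z : ℂ in 𝓝 0, IsUnit ((1 : X →L[ℂ] X) - z • A) := by
  have h1 : Tendsto (fun z : ℂ => ‖z • A‖) (𝓝 0) (𝓝 0) := by
    have : Continuous (fun z : ℂ => ‖z • A‖) := by fun_prop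
    simpa using this.tendsto 0
  filter_upwards [h1.eventually (gt_mem_nhds one_pos)] with z hz
  exact isUnit_one_sub_of_norm_lt_one hz

theorem IsRealizationOf.near (h : IsRealizationOf A B C D S) :
    ∀ᶠ z in 𝓝 0, IsUnit ((1 : X →L[ℂ] X) - z • A) ∧ transferAt A B C D z = S z := by
  obtain ⟨ε, hε, h⟩ := h
  filter_upwards [ball_mem_nhds (0 : ℂ) hε] with z hz
  exact h z (by simpa using hz)

theorem st_gram (hiso : IsIsometricSys J A B C D) {w z : ℂ}
    (hw : IsUnit ((1 : X →L[ℂ] X) - w • A) ∧ transferAt A B C D w = S w)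
    (hz : IsUnit ((1 : X →L[ℂ] X) - z • A) ∧ transferAt A B C D z = S z) (u v : U) :
    (1 - conj w * z) * ⟪J (st A B w u), st A B z v⟫ = ⟪u, v⟫ - ⟪S w u, S z v⟫ := by
  have h := hiso (w • st A B w u) (z • st A B z v) u v
  rw [st_eq hw.1, st_eq hz.1, transfer_st hw.2, transfer_st hz.2, map_smul, inner_smul_left,
    inner_smul_right] at h
  linear_combination h

theorem st_continuousAt (u : U) : ContinuousAt (fun z => st A B z u) 0 := by
  have h1 : ContinuousAt Ring.inverse ((1 : X →L[ℂ] X) - (0 : ℂ) • A) := by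
    simpa using NormedRing.inverse_continuousAt (1 : (X →L[ℂ] X)ˣ)
  have h2 : ContinuousAt (fun z : ℂ => (1 : X →L[ℂ] X) - z • A) 0 := by fun_prop
  have h3 : ContinuousAt (fun z : ℂ => Ring.inverse ((1 : X →L[ℂ] X) - z • A)) 0 :=
    ContinuousAt.comp (f := fun z : ℂ => (1 : X →L[ℂ] X) - z • A) h1 h2
  exact h3.clm_apply continuousAt_const

theorem orth_of_st {f : X} {u : U} (h : ∀ᶠ z in 𝓝 0, ⟪f, st A B z u⟫ = 0) (n : ℕ) :
    ⟪f, (A ^ n) (B u)⟫ = 0 := by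
  suffices h : ∀ n, ∀ᶠ z in 𝓝 0, ⟪f, (A ^ n) (st A B z u)⟫ = 0 by
    have := (h n).self_of_nhds
    rwa [st_zero] at this
  intro n
  induction n with
  | zero => simpa using h
  | succ n ih =>
    have h0 := ih.self_of_nhds
    rw [st_zero] at h0
    have h1 : ∀ᶠ z in 𝓝[≠] 0, ⟪f, (A ^ (n + 1)) (st A B z u)⟫ = 0 := by
      filter_upwards [ih.filter_mono nhdsWithin_le_nhds,
        (isUnit_near A).filter_mono nhdsWithin_le_nhds, self_mem_nhdsWithin] with z hz hu hne
      rw [← st_eq hu, map_add, inner_add_right, h0, add_zero, map_smul, map_smul, inner_smul_right] at hz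
      have := (mul_eq_zero.1 hz).resolve_left hne
      rwa [pow_succ]
    have hc : ContinuousAt (fun z => ⟪f, (A ^ (n + 1)) (st A B z u)⟫) 0 :=
      continuousAt_const.inner ((A ^ (n + 1)).continuous.continuousAt.comp (st_continuousAt u))
    have h2 : ⟪f, (A ^ (n + 1)) (st A B 0 u)⟫ = 0 := by
      refine tendsto_nhds_unique (hc.tendsto.mono_left (nhdsWithin_le_nhds (s := {0}ᶜ))) ?_
      exact tendsto_const_nhds.congr' (h1.mono fun z hz => hz.symm)
    rw [eventually_nhdsWithin_iff] at h1
    filter_upwards [h1] with z hz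
    by_cases hz0 : z = 0
    · rw [hz0]; exact h2
    · exact hz hz0

theorem st_orth {f : X} (h : ∀ n u, ⟪f, (A ^ n) (B u)⟫ = 0) :
    ∀ᶠ z in 𝓝 0, ∀ u, ⟪f, st A B z u⟫ = 0 := by
  have h1 : Tendsto (fun z : ℂ => ‖z‖ * ‖A‖) (𝓝 0) (𝓝 0) := by
    have : Continuous (fun z : ℂ => ‖z‖ * ‖A‖) := by fun_prop
    simpa using this.tendsto 0
  filter_upwards [isUnit_near A, h1.eventually (gt_mem_nhds one_pos)] with z hu hz u
  have h2 : ∀ n, ⟪f, st A B z u⟫ = z ^ n * ⟪f, (A ^ n) (st A B z u)⟫ := by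
    intro n
    induction n with
    | zero => simp
    | succ n ih =>
      rw [ih]
      conv_lhs => rw [← st_eq hu]
      rw [map_add, inner_add_right, h, add_zero, map_smul, map_smul, inner_smul_right, pow_succ,
        pow_succ, mul_assoc]
      rfl
  have h3 : ∀ n, ‖⟪f, st A B z u⟫‖ ≤ (‖z‖ * ‖A‖) ^ n * (‖f‖ * ‖st A B z u‖) := by
    intro n
    rw [h2 n, norm_mul, norm_pow, mul_pow, mul_assoc]
    refine mul_le_mul_of_nonneg_left ?_ (by positivity)
    refine (norm_inner_le_norm _ _).trans ?_
    have h4 : ‖(A ^ n) (st A B z u)‖ ≤ ‖A‖ ^ n * ‖st A B z u‖ := by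
      clear h2
      generalize st A B z u = x
      induction n generalizing x with
      | zero => simp
      | succ n ih =>
        rw [pow_succ, pow_succ, mul_assoc]
        exact (ih (A x)).trans (mul_le_mul_of_nonneg_left (A.le_opNorm x) (by positivity))
    calc ‖f‖ * ‖(A ^ n) (st A B z u)‖ ≤ ‖f‖ * (‖A‖ ^ n * ‖st A B z u‖) := by gcongr
      _ = _ := by ring
  have h5 : Tendsto (fun n : ℕ => (‖z‖ * ‖A‖) ^ n * (‖f‖ * ‖st A B z u‖)) atTop (𝓝 0) := by
    simpa using (tendsto_pow_atTop_nhds_zero_of_lt_one (by positivity) hz).mul_const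
      (‖f‖ * ‖st A B z u‖)
  exact norm_le_zero_iff.1 (ge_of_tendsto' h5 h3)

theorem ctrl_iff : ctrlSpace A B = ⊤ ↔ ∀ f : X, (∀ n u, ⟪f, (A ^ n) (B u)⟫ = 0) → f = 0 := by
  unfold ctrlSpace
  rw [Submodule.topologicalClosure_eq_top_iff, Submodule.eq_bot_iff]
  have h : ∀ f : X, f ∈ (⨆ n : ℕ, LinearMap.range (((A ^ n) ∘L B) : U →ₗ[ℂ] X))ᗮ ↔
      ∀ n u, ⟪f, (A ^ n) (B u)⟫ = 0 := by
    intro f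
    rw [← Submodule.iInf_orthogonal, Submodule.mem_iInf]
    simp only [Submodule.mem_orthogonal']
    constructor
    · intro h n u
      exact h n _ ⟨u, rfl⟩
    · rintro h n _ ⟨u, rfl⟩
      exact h n u
  simp only [h]

/-- good neighbourhood of the origin -/
def good (A : X →L[ℂ] X) (B : U →L[ℂ] X) (C : X →L[ℂ] Y) (D : U →L[ℂ] Y)
    (S : ℂ → (U →L[ℂ] Y)) (Ω : Set ℂ) : Set ℂ :=
  {z | z ∈ Ω ∧ IsUnit ((1 : X →L[ℂ] X) - z • A) ∧ transferAt A B C D z = S z}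

theorem good_mem {Ω : Set ℂ} {κ : ℕ} (hS : MemGenSchur S Ω κ) (h : IsRealizationOf A B C D S) :
    good A B C D S Ω ∈ 𝓝 0 := by
  filter_upwards [hS.isOpen.mem_nhds hS.zero_mem, h.near] with z h1 h2
  exact ⟨h1, h2⟩

theorem st_dense {Ω : Set ℂ} {κ : ℕ} (hS : MemGenSchur S Ω κ) (h : IsRealizationOf A B C D S)
    (hJ : IsSym J) (hc : ctrlSpace A B = ⊤) :
    DenseRange (lc (fun p : good A B C D S Ω × U => st A B p.1 p.2)) := by
  refine denseRange_of_sep hJ fun x hx => ?_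
  have : J x = 0 := by
    refine ctrl_iff.1 hc _ fun n u => orth_of_st ?_ n
    filter_upwards [good_mem hS h] with z hz
    exact hx (⟨z, hz⟩, u)
  rw [← hJ.sq x, this, map_zero]

theorem st_genuine {Ω : Set ℂ} {κ : ℕ} (hS : MemGenSchur S Ω κ) (h : IsRealizationOf A B C D S)
    (hJ : IsFundamentalSymmetry J κ) (hiso : IsIsometricSys J A B C D) (hc : ctrlSpace A B = ⊤) :
    FiniteDimensional ℂ (negSp J) :=
  genuine_of_gen hS hJ (E := good A B C D S Ω) (fun _ hz => hz.1) (st A B)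
    (fun _ hw _ hz u v => st_gram hiso hw.2 hz.2 u v) (st_dense hS h hJ.isSym hc)

/-- the unitary similarity of the state space with the reproducing kernel space. -/
theorem exists_V {Ω : Set ℂ} {κ : ℕ} (hS : MemGenSchur S Ω κ) {JH : H →L[ℂ] H} {k : ℂ → U → H}
    (hK : IsKer S Ω JH k) (hr : IsRealizationOf A B C D S) (hJ : IsSym J)
    (hfin : FiniteDimensional ℂ (negSp J)) (hiso : IsIsometricSys J A B C D)
    (hc : ctrlSpace A B = ⊤) :
    ∃ V : X →L[ℂ] H, Function.Bijective V ∧ (∀ x y, ⟪JH (V x), V y⟫ = ⟪J x, y⟫) ∧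
      ∀ᶠ z in 𝓝 0, ∀ u, V (st A B z u) = k z u := by
  have hfH := hK.fin
  have hJH := hK.sym
  have hd1 := st_dense hS hr hJ hc
  have hd2 : DenseRange (lc (fun p : good A B C D S Ω × U => k p.1 p.2)) := by
    refine denseRange_of_sep hJH fun x hx => hK.sep_near hS fun u => ?_
    filter_upwards [good_mem hS hr] with z hz
    exact hx (⟨z, hz⟩, u)
  have hg : ∀ i j : good A B C D S Ω × U,
      ⟪J (st A B i.1 i.2), st A B j.1 j.2⟫ = ⟪JH (k i.1 i.2), k j.1 j.2⟫ := by
    intro i j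
    have hne : 1 - conj (i.1 : ℂ) * (j.1 : ℂ) ≠ 0 :=
      one_sub_ne (by simpa using norm_lt_of_mem hS i.1.2.1) (norm_lt_of_mem hS j.1.2.1)
    refine mul_left_cancel₀ hne ?_
    rw [st_gram hiso i.1.2.2 j.1.2.2, hK.gram _ i.1.2.1 _ j.1.2.1]
  have hG := gram_eq (J := J) (J' := JH) (k := fun p : good A B C D S Ω × U => st A B p.1 p.2)
    (k' := fun p : good A B C D S Ω × U => k p.1 p.2) hg
  have hle1 := finrank_le hJ hJH _ _ hd1 fun p => (congrArg Complex.re (hG p p)).symm.le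
  have hle2 := finrank_le hJH hJ _ _ hd2 fun p => (congrArg Complex.re (hG p p)).le
  obtain ⟨V, hV⟩ := exists_bounded hJ hJH hle2 _ _ hd1
    fun p => (congrArg Complex.re (hG p p)).symm.le
  obtain ⟨W, hW⟩ := exists_bounded hJH hJ hle1 _ _ hd2 fun p => (congrArg Complex.re (hG p p)).le
  have hWV : ∀ x, W (V x) = x := fun x =>
    hd1.induction_on x (isClosed_eq (by fun_prop) (by fun_prop)) fun p => by rw [hV, hW]
  have hVW : ∀ x, V (W x) = x := fun x =>
    hd2.induction_on x (isClosed_eq (by fun_prop) (by fun_prop)) fun p => by rw [hW, hV]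
  refine ⟨V, ⟨fun x y hxy => by rw [← hWV x, hxy, hWV], fun y => ⟨W y, hVW y⟩⟩, ?_, ?_⟩
  · intro x y
    refine hd1.induction_on x (isClosed_eq (by fun_prop) (by fun_prop)) fun p => ?_
    refine hd1.induction_on y (isClosed_eq (by fun_prop) (by fun_prop)) fun q => ?_
    rw [hV, hV, ← hG p q]
  · filter_upwards [good_mem hS hr] with z hz u
    have := hV (Finsupp.single (⟨z, hz⟩, u) 1)
    simpa using this

end Realizations


section ProductSystem

set_option linter.unusedSectionVars false

variable {U Y₁ Y X₁ X₂ : Type*} [NormedAddCommGroup U] [InnerProductSpace ℂ U] [CompleteSpace U]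
  [NormedAddCommGroup Y₁] [InnerProductSpace ℂ Y₁] [CompleteSpace Y₁]
  [NormedAddCommGroup Y] [InnerProductSpace ℂ Y] [CompleteSpace Y]
  [NormedAddCommGroup X₁] [InnerProductSpace ℂ X₁] [CompleteSpace X₁]
  [NormedAddCommGroup X₂] [InnerProductSpace ℂ X₂] [CompleteSpace X₂]
  {J₁ : X₁ →L[ℂ] X₁} {J₂ : X₂ →L[ℂ] X₂}
  {A₁ : X₁ →L[ℂ] X₁} {B₁ : U →L[ℂ] X₁} {C₁ : X₁ →L[ℂ] Y₁} {D₁ : U →L[ℂ] Y₁}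
  {A₂ : X₂ →L[ℂ] X₂} {B₂ : Y₁ →L[ℂ] X₂} {C₂ : X₂ →L[ℂ] Y} {D₂ : Y₁ →L[ℂ] Y}
  {S₁ : ℂ → (U →L[ℂ] Y₁)} {S₂ : ℂ → (Y₁ →L[ℂ] Y)}

theorem prod_state_eq (x : ProdState X₁ X₂) (u : U) :
    prodA A₁ C₁ A₂ B₂ x + prodB B₁ D₁ B₂ u =
      WithLp.toLp 2 (A₁ x.fst + B₁ u, A₂ x.snd + B₂ (C₁ x.fst + D₁ u)) := by
  have h : prodA A₁ C₁ A₂ B₂ x + prodB B₁ D₁ B₂ u =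
      WithLp.toLp 2 (A₁ x.fst + B₁ u, (B₂ (C₁ x.fst) + A₂ x.snd) + B₂ (D₁ u)) := rfl
  rw [h, map_add]
  congr 2
  abel

theorem prod_out_eq (x : ProdState X₁ X₂) (u : U) :
    prodC C₁ C₂ D₂ x + prodD D₁ D₂ u = C₂ x.snd + D₂ (C₁ x.fst + D₁ u) := by
  have h : prodC C₁ C₂ D₂ x + prodD D₁ D₂ u = (D₂ (C₁ x.fst) + C₂ x.snd) + D₂ (D₁ u) := rfl
  rw [h, map_add]
  abel

theorem prodJ_inner (x y : ProdState X₁ X₂) :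
    ⟪prodJ J₁ J₂ x, y⟫ = ⟪J₁ x.fst, y.fst⟫ + ⟪J₂ x.snd, y.snd⟫ := by
  rw [prodJ_apply]
  exact inner_toLp _ _ _ _

theorem prodJ_inner_toLp (a c : X₁) (b d : X₂) :
    ⟪prodJ J₁ J₂ (WithLp.toLp 2 (a, b)), (WithLp.toLp 2 (c, d) : ProdState X₁ X₂)⟫ =
      ⟪J₁ a, c⟫ + ⟪J₂ b, d⟫ := prodJ_inner _ _

theorem prod_iso (h1 : IsIsometricSys J₁ A₁ B₁ C₁ D₁) (h2 : IsIsometricSys J₂ A₂ B₂ C₂ D₂) :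
    IsIsometricSys (prodJ J₁ J₂) (prodA A₁ C₁ A₂ B₂) (prodB B₁ D₁ B₂) (prodC C₁ C₂ D₂)
        (prodD D₁ D₂) := by
  intro x x' u u'
  have e1 := h1 x.fst x'.fst u u'
  have e2 := h2 x.snd x'.snd (C₁ x.fst + D₁ u) (C₁ x'.fst + D₁ u')
  rw [prod_state_eq, prod_state_eq, prod_out_eq, prod_out_eq, prodJ_inner_toLp, prodJ_inner]
  linear_combination e1 + e2

theorem prod_st (h1 : IsRealizationOf A₁ B₁ C₁ D₁ S₁) :
    ∀ᶠ z in 𝓝 0, ∀ u, st (prodA A₁ C₁ A₂ B₂) (prodB B₁ D₁ B₂) z u =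
      WithLp.toLp 2 (st A₁ B₁ z u, st A₂ B₂ z (S₁ z u)) := by
  filter_upwards [h1.near, isUnit_near A₂, isUnit_near (prodA A₁ C₁ A₂ B₂)] with z hz1 hz2 hz u
  refine st_unique hz ?_
  rw [prod_state_eq]
  have e1 := st_eq (B := B₁) hz1.1 u
  have e2 := st_eq (B := B₂) hz2 (S₁ z u)
  have e3 := transfer_st hz1.2 u
  change WithLp.toLp 2 (A₁ (z • st A₁ B₁ z u) + B₁ u,
    A₂ (z • st A₂ B₂ z (S₁ z u)) + B₂ (C₁ (z • st A₁ B₁ z u) + D₁ u)) = _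
  rw [e1, e3, e2]

theorem prod_real (h1 : IsRealizationOf A₁ B₁ C₁ D₁ S₁) (h2 : IsRealizationOf A₂ B₂ C₂ D₂ S₂) :
    IsRealizationOf (prodA A₁ C₁ A₂ B₂) (prodB B₁ D₁ B₂) (prodC C₁ C₂ D₂) (prodD D₁ D₂)
        (fun z => S₂ z ∘L S₁ z) := by
  have h : ∀ᶠ z in 𝓝 (0 : ℂ), IsUnit ((1 : ProdState X₁ X₂ →L[ℂ] ProdState X₁ X₂) -
      z • prodA A₁ C₁ A₂ B₂) ∧ transferAt (prodA A₁ C₁ A₂ B₂) (prodB B₁ D₁ B₂) (prodC C₁ C₂ D₂)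
        (prodD D₁ D₂) z = S₂ z ∘L S₁ z := by
    filter_upwards [h1.near, h2.near, isUnit_near (prodA A₁ C₁ A₂ B₂), prod_st (A₂ := A₂)
      (B₂ := B₂) h1] with z hz1 hz2 hz hst
    refine ⟨hz, ?_⟩
    ext u
    rw [← transfer_st rfl u, hst, prod_out_eq]
    change C₂ (z • st A₂ B₂ z (S₁ z u)) + D₂ (C₁ (z • st A₁ B₁ z u) + D₁ u) = S₂ z (S₁ z u)
    rw [transfer_st hz1.2, transfer_st hz2.2]
  obtain ⟨ε, hε, h⟩ := Metric.eventually_nhds_iff.1 h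
  exact ⟨ε, hε, fun z hz => h (by simpa using hz)⟩

end ProductSystem


/-- the product of isometric controllable realizations is an isometric
controllable realization of `S = S₂S₁` iff `H(S^#) = S₁^#·H(S₂^#) ⊕ H(S₁^#)` and
multiplication by `S₁^#` is an isometry of `H(S₂^#)` into `H(S^#)`. -/
theorem isometric_controllable_product_iff
    {U Y₁ Y X₁ X₂ H1 H2 HS : Type*}
    [NormedAddCommGroup U] [InnerProductSpace ℂ U] [CompleteSpace U] [NormedAddCommGroup Y₁] [InnerProductSpace ℂ Y₁] [CompleteSpace Y₁] [NormedAddCommGroup Y] [InnerProductSpace ℂ Y] [CompleteSpace Y] [NormedAddCommGroup X₁] [InnerProductSpace ℂ X₁] [CompleteSpace X₁] [NormedAddCommGroup X₂] [InnerProductSpace ℂ X₂] [CompleteSpace X₂]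
    [NormedAddCommGroup H1] [InnerProductSpace ℂ H1] [CompleteSpace H1] [NormedAddCommGroup H2] [InnerProductSpace ℂ H2] [CompleteSpace H2] [NormedAddCommGroup HS] [InnerProductSpace ℂ HS] [CompleteSpace HS]
    (κ₁ κ₂ κS : ℕ)
    (S₁ : ℂ → (U →L[ℂ] Y₁)) (S₂ : ℂ → (Y₁ →L[ℂ] Y)) (Ω : Set ℂ)
    (hΩsym : ∀ z ∈ Ω, starRingEnd ℂ z ∈ Ω)
    (hS₁ : MemGenSchur S₁ Ω κ₁) (hS₂ : MemGenSchur S₂ Ω κ₂)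
    (hS : MemGenSchur (fun z => S₂ z ∘L S₁ z) Ω κS)
    (J₁ : X₁ →L[ℂ] X₁) (J₂ : X₂ →L[ℂ] X₂)
    (hJ₁ : IsFundamentalSymmetry J₁ κ₁) (hJ₂ : IsFundamentalSymmetry J₂ κ₂)
    (A₁ : X₁ →L[ℂ] X₁) (B₁ : U →L[ℂ] X₁) (C₁ : X₁ →L[ℂ] Y₁) (D₁ : U →L[ℂ] Y₁)
    (A₂ : X₂ →L[ℂ] X₂) (B₂ : Y₁ →L[ℂ] X₂) (C₂ : X₂ →L[ℂ] Y) (D₂ : Y₁ →L[ℂ] Y)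
    (h1iso : IsIsometricSys J₁ A₁ B₁ C₁ D₁) (h1ctrl : ctrlSpace A₁ B₁ = ⊤)
    (h1real : IsRealizationOf A₁ B₁ C₁ D₁ S₁)
    (h2iso : IsIsometricSys J₂ A₂ B₂ C₂ D₂) (h2ctrl : ctrlSpace A₂ B₂ = ⊤)
    (h2real : IsRealizationOf A₂ B₂ C₂ D₂ S₂)
    (JH1 : H1 →L[ℂ] H1) (ev1 : H1 →ₗ[ℂ] (ℂ → U)) (hH1 : IsRKPS (sharp S₁) Ω κ₁ JH1 ev1)
    (JH2 : H2 →L[ℂ] H2) (ev2 : H2 →ₗ[ℂ] (ℂ → Y₁)) (hH2 : IsRKPS (sharp S₂) Ω κ₂ JH2 ev2)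
    (JHS : HS →L[ℂ] HS) (evS : HS →ₗ[ℂ] (ℂ → U))
    (hHS : IsRKPS (sharp (fun z => S₂ z ∘L S₁ z)) Ω κS JHS evS) :
    (IsIsometricSys (prodJ J₁ J₂) (prodA A₁ C₁ A₂ B₂) (prodB B₁ D₁ B₂) (prodC C₁ C₂ D₂)
        (prodD D₁ D₂) ∧
      ctrlSpace (prodA A₁ C₁ A₂ B₂) (prodB B₁ D₁ B₂) = ⊤ ∧
      IsRealizationOf (prodA A₁ C₁ A₂ B₂) (prodB B₁ D₁ B₂) (prodC C₁ C₂ D₂) (prodD D₁ D₂)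
        (fun z => S₂ z ∘L S₁ z)) ↔
    (((∀ g : HS, ∃! p : H2 × H1, ∀ z ∈ Ω, evS g z = sharp S₁ z (ev2 p.1 z) + ev1 p.2 z) ∧
      (∀ h₁ : H1, ∃ g : HS, ∀ z ∈ Ω, evS g z = ev1 h₁ z) ∧
      (∀ (h₁ h₁' : H1) (g g' : HS), (∀ z ∈ Ω, evS g z = ev1 h₁ z) →
        (∀ z ∈ Ω, evS g' z = ev1 h₁' z) → ⟪JHS g, g'⟫ = ⟪JH1 h₁, h₁'⟫) ∧
      (∀ (h₂ : H2) (h₁ : H1) (g g' : HS), (∀ z ∈ Ω, evS g z = sharp S₁ z (ev2 h₂ z)) →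
        (∀ z ∈ Ω, evS g' z = ev1 h₁ z) → ⟪JHS g, g'⟫ = 0)) ∧
     ((∀ h₂ : H2, ∃ g : HS, ∀ z ∈ Ω, evS g z = sharp S₁ z (ev2 h₂ z)) ∧
      (∀ (h₂ h₂' : H2) (g g' : HS), (∀ z ∈ Ω, evS g z = sharp S₁ z (ev2 h₂ z)) →
        (∀ z ∈ Ω, evS g' z = sharp S₁ z (ev2 h₂' z)) → ⟪JHS g, g'⟫ = ⟪JH2 h₂, h₂'⟫))) := by
  obtain ⟨k1, hK1, hev1⟩ := exists_isKer hS₁ hΩsym hH1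
  obtain ⟨k2, hK2, hev2⟩ := exists_isKer hS₂ hΩsym hH2
  obtain ⟨kS, hKS, hevS⟩ := exists_isKer hS hΩsym hHS
  have hf1 := st_genuine hS₁ h1real hJ₁ h1iso h1ctrl
  have hf2 := st_genuine hS₂ h2real hJ₂ h2iso h2ctrl
  obtain ⟨V1, hV1, hi1, hk1⟩ := exists_V hS₁ hK1 h1real hJ₁.isSym hf1 h1iso h1ctrl
  obtain ⟨V2, hV2, hi2, hk2⟩ := exists_V hS₂ hK2 h2real hJ₂.isSym hf2 h2iso h2ctrl
  have hPiso := prod_iso h1iso h2iso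
  have hPreal := prod_real h1real h2real
  have hPst := prod_st (A₂ := A₂) (B₂ := B₂) h1real
  have hPJ := prodJ_isSym hJ₁.isSym hJ₂.isSym
  have hPf : FiniteDimensional ℂ (negSp (prodJ J₁ J₂)) := negSp_prodJ_finite hf1 hf2
  -- passing from inner products with the kernels to function values
  have hrel : ∀ (g : HS) (h₂ : H2) (h₁ : H1),
      (∀ u, ∀ᶠ v in 𝓝 0, ⟪JHS g, kS v u⟫ = ⟪JH2 h₂, k2 v (S₁ v u)⟫ + ⟪JH1 h₁, k1 v u⟫) →
      ∀ z ∈ Ω, evS g z = sharp S₁ z (ev2 h₂ z) + ev1 h₁ z := by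
    intro g h₂ h₁ hn z hz
    refine ext_inner_right ℂ fun u => ?_
    have hc := hΩsym z hz
    have h := propagate hS₁ hS₂ hS hK1 hK2 hKS g h₂ h₁ hn (conj z) hc u
    rw [hevS _ hc, hev2 _ hc, hev1 _ hc, Complex.conj_conj] at h
    rw [h, inner_add_left, sharp, adjoint_inner_left]
  -- inner products with product states
  have hprod : ∀ x : ProdState X₁ X₂, ∀ᶠ z in 𝓝 0, ∀ u,
      ⟪prodJ J₁ J₂ x, st (prodA A₁ C₁ A₂ B₂) (prodB B₁ D₁ B₂) z u⟫ =
        ⟪JH2 (V2 x.snd), k2 z (S₁ z u)⟫ + ⟪JH1 (V1 x.fst), k1 z u⟫ := by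
    intro x
    filter_upwards [hPst, hk1, hk2] with z h0 h1 h2 u
    rw [h0, ← h1, ← h2, hi1, hi2, prodJ_inner, add_comm]
    rfl
  constructor
  · rintro ⟨-, hctrl, -⟩
    obtain ⟨V, hV, hi, hk⟩ := exists_V hS hKS hPreal hPJ hPf hPiso hctrl
    have hR : ∀ x₁ x₂, ∀ z ∈ Ω,
        evS (V (WithLp.toLp 2 (x₁, x₂))) z = sharp S₁ z (ev2 (V2 x₂) z) + ev1 (V1 x₁) z := by
      intro x₁ x₂
      refine hrel _ _ _ fun u => ?_
      filter_upwards [hk, hprod (WithLp.toLp 2 (x₁, x₂))] with z h1 h2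
      rw [← h1, hi, h2]
      rfl
    have hU : ∀ g x₁ x₂, (∀ z ∈ Ω, evS g z = sharp S₁ z (ev2 (V2 x₂) z) + ev1 (V1 x₁) z) →
        g = V (WithLp.toLp 2 (x₁, x₂)) := by
      intro g x₁ x₂ h
      refine sub_eq_zero.1 (hHS.sep _ fun z hz => ?_)
      rw [map_sub, Pi.sub_apply, h z hz, hR x₁ x₂ z hz, sub_self]
    have hU1 : ∀ g x₁, (∀ z ∈ Ω, evS g z = ev1 (V1 x₁) z) → g = V (WithLp.toLp 2 (x₁, 0)) := by
      intro g x₁ h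
      refine hU g x₁ 0 fun z hz => ?_
      rw [h z hz]; simp
    have hU2 : ∀ g x₂, (∀ z ∈ Ω, evS g z = sharp S₁ z (ev2 (V2 x₂) z)) →
        g = V (WithLp.toLp 2 (0, x₂)) := by
      intro g x₂ h
      refine hU g 0 x₂ fun z hz => ?_
      rw [h z hz]; simp
    refine ⟨⟨?_, ?_, ?_, ?_⟩, ?_, ?_⟩
    · intro g
      obtain ⟨x, rfl⟩ := hV.2 g
      refine ⟨(V2 x.snd, V1 x.fst), fun z hz => hR x.fst x.snd z hz, ?_⟩
      rintro ⟨p2, p1⟩ hp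
      obtain ⟨y₁, rfl⟩ := hV1.2 p1
      obtain ⟨y₂, rfl⟩ := hV2.2 p2
      have hx := hV.1 (hU _ y₁ y₂ hp)
      rw [hx]
      rfl
    · intro h₁
      obtain ⟨y₁, rfl⟩ := hV1.2 h₁
      refine ⟨V (WithLp.toLp 2 (y₁, 0)), fun z hz => ?_⟩
      rw [hR y₁ 0 z hz]; simp
    · intro h₁ h₁' g g' hg hg'
      obtain ⟨y₁, rfl⟩ := hV1.2 h₁
      obtain ⟨y₁', rfl⟩ := hV1.2 h₁'
      rw [hU1 _ _ hg, hU1 _ _ hg', hi, hi1, prodJ_inner_toLp]; simp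
    · intro h₂ h₁ g g' hg hg'
      obtain ⟨y₁, rfl⟩ := hV1.2 h₁
      obtain ⟨y₂, rfl⟩ := hV2.2 h₂
      rw [hU2 _ _ hg, hU1 _ _ hg', hi, prodJ_inner_toLp]; simp
    · intro h₂
      obtain ⟨y₂, rfl⟩ := hV2.2 h₂
      refine ⟨V (WithLp.toLp 2 (0, y₂)), fun z hz => ?_⟩
      rw [hR 0 y₂ z hz]; simp
    · intro h₂ h₂' g g' hg hg'
      obtain ⟨y₂, rfl⟩ := hV2.2 h₂
      obtain ⟨y₂', rfl⟩ := hV2.2 h₂'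
      rw [hU2 _ _ hg, hU2 _ _ hg', hi, hi2, prodJ_inner_toLp]; simp
  · rintro ⟨⟨huniq, -⟩, -⟩
    refine ⟨hPiso, ctrl_iff.2 fun f hf => ?_, hPreal⟩
    have hx0 : prodJ J₁ J₂ f = 0 := by
      set x := prodJ J₁ J₂ f with hx
      have hfx : f = prodJ J₁ J₂ x := (hPJ.sq f).symm
      have h := hrel 0 (V2 x.snd) (V1 x.fst) fun u => by
        filter_upwards [hprod x, st_orth hf] with z h1 h2
        rw [← h1, ← hfx, h2, map_zero, inner_zero_left]
      have hp := (huniq 0).unique (y₁ := (V2 x.snd, V1 x.fst)) (y₂ := (0, 0)) h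
        (fun z hz => by simp)
      have e2 : x.snd = 0 := hV2.1 (by rw [map_zero]; exact congrArg Prod.fst hp)
      have e1 : x.fst = 0 := hV1.1 (by rw [map_zero]; exact congrArg Prod.snd hp)
      exact (hPJ.eq_zero fun y => by rw [prodJ_inner, e1, e2]; simp)
    rw [← hPJ.sq f, hx0, map_zero]

end Pontryagin
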